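/- arXiv:1811.06205 — 4 statements merged into one kernel-verified Lean document; each statement's English description precedes it below -/
import Mathlib

section
/- Let G be a finite pseudoreflection subgroup of GL(n,ℂ), d = |G|, let p₁,…,p_d be a basis of ℂ[z] as a module over ℂ[z]^G, and let Λ be the d×d matrix with (i,j)-entry ρᵢ·p_j. Let H₁,…,H_r be the distinct reflecting hyperplanes of G, for each i let K_i = {σ ∈ G : σ fixes H_i pointwise} with m_i = |K_i|, and let L_i be a nonzero homogeneous linear polynomial with H_i = {z : L_i(z) = 0}. Then there is a nonzero constant c ∈ ℂ such that det Λ = c·∏_{i=1}^r L_i^{d(m_i−1)/2}. -/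
open MvPolynomial

noncomputable section

/-- The natural action of an invertible matrix on `ℂⁿ` by matrix-vector multiplication. -/
def gAct {n : ℕ} (σ : GL (Fin n) ℂ) (z : Fin n → ℂ) : Fin n → ℂ :=
  Matrix.mulVec (σ : Matrix (Fin n) (Fin n) ℂ) z

/-- A pseudoreflection: an element of finite order in `GL(n,ℂ)` with `rank (1 - ρ) = 1`. -/
def IsPseudoreflection {n : ℕ} (ρ : GL (Fin n) ℂ) : Prop :=
  IsOfFinOrder ρ ∧ Matrix.rank ((1 : Matrix (Fin n) (Fin n) ℂ) - (ρ : Matrix (Fin n) (Fin n) ℂ)) = 1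

/-- A subgroup of `GL(n,ℂ)` is a pseudoreflection group if it is generated by the
pseudoreflections it contains. -/
def IsPseudoreflectionGroup {n : ℕ} (G : Subgroup (GL (Fin n) ℂ)) : Prop :=
  Subgroup.closure {ρ : GL (Fin n) ℂ | ρ ∈ G ∧ IsPseudoreflection ρ} = G

/-- The action of `σ ∈ GL(n,ℂ)` on polynomials: `(σ·p)(z) = p(σ⁻¹z)`. -/
def polyAct {n : ℕ} (σ : GL (Fin n) ℂ) (p : MvPolynomial (Fin n) ℂ) : MvPolynomial (Fin n) ℂ :=
  MvPolynomial.aeval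
    (fun i => ∑ j, MvPolynomial.C (((σ⁻¹ : GL (Fin n) ℂ) : Matrix (Fin n) (Fin n) ℂ) i j)
      * MvPolynomial.X j) p

/-- The polynomial map `θ : ℂⁿ → ℂⁿ` associated to a tuple of polynomials. -/
def polyMap {n : ℕ} (θ : Fin n → MvPolynomial (Fin n) ℂ) (z : Fin n → ℂ) : Fin n → ℂ :=
  fun i => MvPolynomial.eval z (θ i)

/-- The action of a matrix on polynomials, as an algebra homomorphism. -/
def polyActHom {n : ℕ} (σ : GL (Fin n) ℂ) :
    MvPolynomial (Fin n) ℂ →ₐ[ℂ] MvPolynomial (Fin n) ℂ :=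
  MvPolynomial.aeval
    (fun i => ∑ j, MvPolynomial.C (((σ⁻¹ : GL (Fin n) ℂ) : Matrix (Fin n) (Fin n) ℂ) i j)
      * MvPolynomial.X j)

theorem polyAct_eq_polyActHom {n : ℕ} (σ : GL (Fin n) ℂ) (p : MvPolynomial (Fin n) ℂ) :
    polyAct σ p = polyActHom σ p := rfl

/-- The linear form with coefficient vector `v`. -/
def linForm {n : ℕ} : (Fin n → ℂ) →ₗ[ℂ] MvPolynomial (Fin n) ℂ :=
  Fintype.linearCombination ℂ MvPolynomial.X

theorem linForm_apply {n : ℕ} (v : Fin n → ℂ) :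
    linForm v = ∑ i, C (v i) * X i := by
  simp [linForm, Fintype.linearCombination_apply, MvPolynomial.smul_eq_C_mul]

theorem linForm_single {n : ℕ} (i : Fin n) : linForm (Pi.single i 1) = X i := by
  simp [linForm, Fintype.linearCombination_apply_single]

theorem eval_linForm {n : ℕ} (v z : Fin n → ℂ) : eval z (linForm v) = v ⬝ᵥ z := by
  simp [linForm_apply, dotProduct]

theorem polyActHom_X {n : ℕ} (σ : GL (Fin n) ℂ) (i : Fin n) :
    polyActHom σ (X i) = linForm (((σ⁻¹ : GL (Fin n) ℂ) : Matrix (Fin n) (Fin n) ℂ) i) := by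
  simp [polyActHom, linForm_apply]

theorem polyActHom_linForm {n : ℕ} (σ : GL (Fin n) ℂ) (v : Fin n → ℂ) :
    polyActHom σ (linForm v) =
      linForm (Matrix.vecMul v ((σ⁻¹ : GL (Fin n) ℂ) : Matrix (Fin n) (Fin n) ℂ)) := by
  rw [Matrix.vecMul_eq_sum, map_sum, linForm_apply, map_sum]
  refine Finset.sum_congr rfl fun i _ => ?_
  rw [map_smul, ← polyActHom_X, ← MvPolynomial.smul_eq_C_mul, map_smul]

theorem polyActHom_mul {n : ℕ} (σ τ : GL (Fin n) ℂ) (p : MvPolynomial (Fin n) ℂ) :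
    polyActHom (σ * τ) p = polyActHom σ (polyActHom τ p) := by
  have : polyActHom (σ * τ) = (polyActHom σ).comp (polyActHom τ) := by
    refine MvPolynomial.algHom_ext fun i => ?_
    rw [AlgHom.comp_apply, ← linForm_single, polyActHom_linForm, polyActHom_linForm,
      polyActHom_linForm, Matrix.vecMul_vecMul, mul_inv_rev, Units.val_mul]
  rw [this, AlgHom.comp_apply]

theorem polyActHom_one {n : ℕ} (p : MvPolynomial (Fin n) ℂ) :
    polyActHom (1 : GL (Fin n) ℂ) p = p := by
  have : polyActHom (1 : GL (Fin n) ℂ) = AlgHom.id ℂ _ := by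
    refine MvPolynomial.algHom_ext fun i => ?_
    rw [← linForm_single, polyActHom_linForm]
    simp
  rw [this, AlgHom.id_apply]

theorem eval_polyActHom {n : ℕ} (σ : GL (Fin n) ℂ) (z : Fin n → ℂ)
    (p : MvPolynomial (Fin n) ℂ) :
    eval z (polyActHom σ p) = eval (gAct σ⁻¹ z) p := by
  induction p using MvPolynomial.induction_on with
  | C a => rw [← algebraMap_eq, AlgHom.commutes, algebraMap_eq, eval_C, eval_C]
  | add p q hp hq => simp [hp, hq]
  | mul_X p i hp =>
    rw [map_mul, map_mul, map_mul, hp, polyActHom_X, eval_linForm, eval_X]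
    rfl

theorem isHomogeneous_linForm {n : ℕ} (v : Fin n → ℂ) : (linForm v).IsHomogeneous 1 := by
  rw [linForm_apply]
  exact IsHomogeneous.sum _ _ _ fun i _ => isHomogeneous_C_mul_X _ _

theorem coeff_linForm {n : ℕ} (v : Fin n → ℂ) (i : Fin n) :
    coeff (Finsupp.single i 1) (linForm v) = v i := by
  simp [linForm_apply, coeff_sum, coeff_C_mul, coeff_X,
    Finsupp.single_left_inj]

theorem linForm_injective {n : ℕ} : Function.Injective (linForm (n := n)) := fun v w h => by
  ext i
  rw [← coeff_linForm v, h, coeff_linForm]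

theorem exists_eq_linForm {n : ℕ} {L : MvPolynomial (Fin n) ℂ} (h : L.IsHomogeneous 1) :
    ∃ w, L = linForm w := by
  refine ⟨fun i => coeff (Finsupp.single i 1) L, ?_⟩
  ext d
  by_cases hd : d.degree = 1
  · obtain ⟨i, rfl⟩ := (Finsupp.sum_eq_one_iff d).1 hd
    rw [coeff_linForm]
  · rw [h.coeff_eq_zero hd, (isHomogeneous_linForm _).coeff_eq_zero hd]

theorem totalDegree_linForm {n : ℕ} {v : Fin n → ℂ} (hv : linForm v ≠ 0) :
    (linForm v).totalDegree = 1 := (isHomogeneous_linForm v).totalDegree hv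

theorem irreducible_linForm {n : ℕ} {v : Fin n → ℂ} (hv : linForm v ≠ 0) :
    Irreducible (linForm v) := by
  refine irreducible_of_totalDegree_eq_one (totalDegree_linForm hv) fun x hx => ?_
  refine isUnit_iff_ne_zero.2 fun h0 => hv (MvPolynomial.ext _ _ fun d => ?_)
  simpa [h0] using hx d

theorem Irreducible.not_sq_dvd_linForm {n : ℕ} {P : MvPolynomial (Fin n) ℂ} (hP : Irreducible P)
    {v : Fin n → ℂ} (hv : linForm v ≠ 0) : ¬ P ^ 2 ∣ linForm v := by
  rw [pow_two]
  intro h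
  have hsq := irreducible_linForm hv
  exact hP.not_isUnit (hsq.squarefree P h)

theorem linForm_dvd_of_ker_le {n : ℕ} {w v : Fin n → ℂ} (hw : w ≠ 0)
    (h : ∀ z, w ⬝ᵥ z = 0 → v ⬝ᵥ z = 0) : linForm w ∣ linForm v := by
  obtain ⟨k, hk⟩ := Function.ne_iff.1 hw
  rw [Pi.zero_apply] at hk
  have : v = (v k / w k) • w := by
    ext j
    have := h (w k • Pi.single j 1 - w j • Pi.single k 1) (by simp [mul_comm])
    simp only [dotProduct_sub, dotProduct_smul, dotProduct_single, mul_one, smul_eq_mul] at this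
    rw [Pi.smul_apply, smul_eq_mul]
    field_simp
    linear_combination this
  rw [this, map_smul, MvPolynomial.smul_eq_C_mul]
  exact dvd_mul_left _ _

/-- The inertia group of a polynomial `P` in `G`: the elements acting trivially modulo `P`. -/
def inertia {n : ℕ} (G : Subgroup (GL (Fin n) ℂ)) (P : MvPolynomial (Fin n) ℂ) : Subgroup G where
  carrier := {σ | ∀ q, P ∣ polyActHom (σ : GL (Fin n) ℂ) q - q}
  one_mem' q := by simp [polyActHom_one]
  mul_mem' {σ τ} hσ hτ q := by
    have := dvd_add (hσ (polyActHom (τ : GL (Fin n) ℂ) q)) (hτ q)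
    rwa [sub_add_sub_cancel, ← polyActHom_mul] at this
  inv_mem' {σ} hσ q := by
    have := hσ (polyActHom ((σ⁻¹ : G) : GL (Fin n) ℂ) q)
    rw [← polyActHom_mul, ← Subgroup.coe_mul, mul_inv_cancel, Subgroup.coe_one,
      polyActHom_one] at this
    rwa [← dvd_neg, neg_sub]

theorem mem_inertia {n : ℕ} {G : Subgroup (GL (Fin n) ℂ)} {P : MvPolynomial (Fin n) ℂ} {σ : G} :
    σ ∈ inertia G P ↔ ∀ q, P ∣ polyActHom (σ : GL (Fin n) ℂ) q - q := Iff.rfl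

theorem mem_inertia_of_linForm {n : ℕ} {G : Subgroup (GL (Fin n) ℂ)}
    {P : MvPolynomial (Fin n) ℂ} {σ : G}
    (h : ∀ v, P ∣ polyActHom (σ : GL (Fin n) ℂ) (linForm v) - linForm v) :
    σ ∈ inertia G P := fun q => by
  induction q using MvPolynomial.induction_on with
  | C a => rw [← algebraMap_eq, AlgHom.commutes, sub_self]; exact dvd_zero _
  | add p q hp hq => rw [map_add, add_sub_add_comm]; exact dvd_add hp hq
  | mul_X p i hp =>
    have hX := h (Pi.single i 1)
    rw [linForm_single] at hX
    have : polyActHom (σ : GL (Fin n) ℂ) (p * X i) - p * X i =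
        (polyActHom (σ : GL (Fin n) ℂ) p - p) * polyActHom (σ : GL (Fin n) ℂ) (X i) +
          p * (polyActHom (σ : GL (Fin n) ℂ) (X i) - X i) := by
      rw [map_mul]; ring
    rw [this]
    exact dvd_add (hp.mul_right _) (hX.mul_left _)

theorem inertia_eq_of_associated {n : ℕ} {G : Subgroup (GL (Fin n) ℂ)}
    {P Q : MvPolynomial (Fin n) ℂ} (h : Associated P Q) : inertia G P = inertia G Q := by
  ext σ
  simp only [mem_inertia, h.dvd_iff_dvd_left]

theorem polyActHom_faithful {n : ℕ} {σ τ : GL (Fin n) ℂ}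
    (h : ∀ v, polyActHom σ (linForm v) = polyActHom τ (linForm v)) : σ = τ := by
  rw [← inv_inj]
  refine Units.ext (Matrix.ext_of_single_vecMul fun i => ?_)
  have := h (Pi.single i 1)
  rw [polyActHom_linForm, polyActHom_linForm] at this
  exact linForm_injective this

/-- Elements acting trivially modulo a linear form are those fixing its kernel pointwise. -/
theorem mem_inertia_linForm_iff {n : ℕ} {G : Subgroup (GL (Fin n) ℂ)} {w : Fin n → ℂ}
    (hw : w ≠ 0) {σ : G} :
    σ ∈ inertia G (linForm w) ↔ ∀ z, eval z (linForm w) = 0 → gAct (σ : GL (Fin n) ℂ) z = z := by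
  have key : ∀ z, gAct (σ : GL (Fin n) ℂ) z = z ↔ gAct (σ : GL (Fin n) ℂ)⁻¹ z = z := by
    intro z
    constructor <;> intro h
    · nth_rw 1 [← h]
      simp [gAct, Matrix.mulVec_mulVec]
    · nth_rw 1 [← h]
      simp [gAct, Matrix.mulVec_mulVec]
  constructor
  · intro h z hz
    rw [key]
    ext i
    obtain ⟨c, hc⟩ := h (X i)
    have := congr_arg (eval z) hc
    rw [map_sub, eval_polyActHom, map_mul, hz, zero_mul, eval_X, eval_X] at this
    exact sub_eq_zero.1 this
  · intro h
    refine mem_inertia_of_linForm fun v => ?_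
    rw [polyActHom_linForm, ← map_sub]
    set v' := Matrix.vecMul v (((σ : GL (Fin n) ℂ)⁻¹ : GL (Fin n) ℂ) : Matrix (Fin n) (Fin n) ℂ) - v
      with hv'
    have hz : ∀ z, w ⬝ᵥ z = 0 → v' ⬝ᵥ z = 0 := by
      intro z hz
      have := (key z).1 (h z (by rwa [eval_linForm]))
      rw [hv', sub_dotProduct, ← Matrix.dotProduct_mulVec]
      change v ⬝ᵥ gAct _ z - _ = 0
      rw [this, sub_self]
    exact linForm_dvd_of_ker_le hw hz

theorem eq_smul_of_linForm_dvd {n : ℕ} {w v : Fin n → ℂ} (hw : w ≠ 0)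
    (h : linForm w ∣ linForm v) : ∃ c : ℂ, v = c • w := by
  by_cases hv : linForm v = 0
  · exact ⟨0, by rw [zero_smul]; exact linForm_injective (by rw [hv, map_zero])⟩
  have hw' : linForm w ≠ 0 := (map_ne_zero_iff _ linForm_injective).2 hw
  obtain ⟨u, hu⟩ := (irreducible_linForm hw').associated_of_dvd (irreducible_linForm hv) h
  obtain ⟨c, -, hc⟩ := isUnit_iff_eq_C_of_isReduced.1 u.isUnit
  refine ⟨c, linForm_injective ?_⟩
  rw [map_smul, MvPolynomial.smul_eq_C_mul, ← hu, hc, mul_comm]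

theorem exists_polyActHom_linForm_eq {n : ℕ} {G : Subgroup (GL (Fin n) ℂ)} {w : Fin n → ℂ}
    (hw : w ≠ 0) {κ : G} (hκ : κ ∈ inertia G (linForm w)) (v : Fin n → ℂ) :
    ∃ c : ℂ, polyActHom (κ : GL (Fin n) ℂ) (linForm v) = linForm v + C c * linForm w := by
  have h := hκ (linForm v)
  rw [polyActHom_linForm, ← map_sub] at h
  obtain ⟨c, hc⟩ := eq_smul_of_linForm_dvd hw h
  refine ⟨c, ?_⟩
  rw [polyActHom_linForm, ← MvPolynomial.smul_eq_C_mul, ← map_smul, ← hc, ← map_add]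
  congr 1
  abel

/-- The inertia group of a linear form acts on this form through a faithful character. -/
theorem exists_inertia_character {n : ℕ} {G : Subgroup (GL (Fin n) ℂ)} [Finite G]
    {w : Fin n → ℂ} (hw : w ≠ 0) :
    ∃ χ : inertia G (linForm w) →* ℂ, Function.Injective χ ∧
      ∀ κ : inertia G (linForm w),
        polyActHom ((κ : G) : GL (Fin n) ℂ) (linForm w) = C (χ κ) * linForm w := by
  have hw' : linForm w ≠ 0 := (map_ne_zero_iff _ linForm_injective).2 hw
  have hex : ∀ κ : inertia G (linForm w), ∃ c : ℂ,
      polyActHom ((κ : G) : GL (Fin n) ℂ) (linForm w) = C c * linForm w := fun κ => by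
    obtain ⟨c, hc⟩ := exists_polyActHom_linForm_eq hw κ.2 w
    exact ⟨1 + c, by rw [hc, C_add, C_1]; ring⟩
  choose χ hχ using hex
  have hone : χ 1 = 1 := by
    have := hχ 1
    rw [Subgroup.coe_one, Subgroup.coe_one, polyActHom_one] at this
    refine C_injective (Fin n) ℂ (mul_right_cancel₀ hw' ?_)
    rw [← this, C_1, one_mul]
  have hmul : ∀ κ κ', χ (κ * κ') = χ κ * χ κ' := fun κ κ' => by
    have := hχ (κ * κ')
    rw [Subgroup.coe_mul, Subgroup.coe_mul, polyActHom_mul, hχ κ', map_mul, hχ κ,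
      ← algebraMap_eq, AlgHom.commutes, algebraMap_eq] at this
    refine C_injective (Fin n) ℂ (mul_right_cancel₀ hw' ?_)
    rw [← this, C_mul]; ring
  refine ⟨⟨⟨χ, hone⟩, hmul⟩, (injective_iff_map_eq_one _).2 fun κ hκ => ?_, hχ⟩
  have hκ1 : polyActHom ((κ : G) : GL (Fin n) ℂ) (linForm w) = linForm w := by
    rw [hχ κ, show χ κ = 1 from hκ, C_1, one_mul]
  have hfix : ∀ v, polyActHom ((κ : G) : GL (Fin n) ℂ) (linForm v) = linForm v := by
    intro v
    obtain ⟨c, hc⟩ := exists_polyActHom_linForm_eq hw κ.2 v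
    have hpow : ∀ k : ℕ, polyActHom (((κ : G) : GL (Fin n) ℂ) ^ k) (linForm v) =
        linForm v + C (k * c) * linForm w := by
      intro k
      induction k with
      | zero => simp [polyActHom_one]
      | succ k ih =>
        rw [pow_succ', polyActHom_mul, ih, map_add, map_mul, hc, hκ1, ← algebraMap_eq,
          AlgHom.commutes, algebraMap_eq]
        push_cast
        rw [add_mul, one_mul, C_add]
        ring
    have hord := hpow (Nat.card (inertia G (linForm w)))
    have hκpow : ((κ : G) : GL (Fin n) ℂ) ^ Nat.card (inertia G (linForm w)) = 1 := by
      rw [← Subgroup.coe_pow, ← Subgroup.coe_pow, pow_card_eq_one', Subgroup.coe_one,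
        Subgroup.coe_one]
    rw [hκpow, polyActHom_one, left_eq_add, mul_eq_zero, or_iff_left hw', C_eq_zero,
      mul_eq_zero, Nat.cast_eq_zero, or_iff_right Nat.card_pos.ne'] at hord
    rw [hc, hord, C_0, zero_mul, add_zero]
  refine Subtype.ext (Subtype.ext (polyActHom_faithful fun v => ?_))
  rw [hfix v, Subgroup.coe_one, Subgroup.coe_one, polyActHom_one]

/-- A semi-invariant of the inertia group whose weight is the `a`-th power of the character of
the linear form is divisible by the `a`-th power of this form. -/
theorem pow_dvd_of_semiinvariant {n : ℕ} {G : Subgroup (GL (Fin n) ℂ)} [Finite G]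
    {w : Fin n → ℂ} (hw : w ≠ 0) {χ : inertia G (linForm w) →* ℂ} (hinj : Function.Injective χ)
    (hχ : ∀ κ : inertia G (linForm w),
      polyActHom ((κ : G) : GL (Fin n) ℂ) (linForm w) = C (χ κ) * linForm w)
    (a : ℕ) (ha : a < Nat.card (inertia G (linForm w))) (f : MvPolynomial (Fin n) ℂ)
    (hf : ∀ κ : inertia G (linForm w),
      polyActHom ((κ : G) : GL (Fin n) ℂ) f = C (χ κ ^ a) * f) :
    linForm w ^ a ∣ f := by
  have hw' : linForm w ≠ 0 := (map_ne_zero_iff _ linForm_injective).2 hw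
  induction a generalizing f with
  | zero => simp
  | succ a ih =>
    obtain ⟨κ, hκ⟩ : ∃ κ, χ κ ^ (a + 1) ≠ 1 := by
      by_contra! hall
      have := Fintype.ofFinite (inertia G (linForm w))
      have hsub : Finset.univ.image χ ⊆ (Polynomial.nthRoots (a + 1) (1 : ℂ)).toFinset := by
        intro x hx
        obtain ⟨κ, -, rfl⟩ := Finset.mem_image.1 hx
        rw [Multiset.mem_toFinset, Polynomial.mem_nthRoots a.succ_pos, hall]
      have h1 := Finset.card_le_card hsub
      rw [Finset.card_image_of_injective _ hinj, Finset.card_univ, ← Nat.card_eq_fintype_card] at h1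
      have h2 := Multiset.toFinset_card_le (Polynomial.nthRoots (a + 1) (1 : ℂ))
      have h3 := Polynomial.card_nthRoots (a + 1) (1 : ℂ)
      omega
    have hdvd : linForm w ∣ f := by
      have h := κ.2 f
      rw [hf, ← sub_one_mul, ← C_1, ← C_sub] at h
      exact ((isUnit_iff_ne_zero.2 (sub_ne_zero.2 hκ)).map C).dvd_mul_left.1 h
    obtain ⟨g, rfl⟩ := hdvd
    rw [pow_succ']
    refine mul_dvd_mul_left _ (ih (by omega) g fun κ => ?_)
    have h := hf κ
    have hne : χ κ ≠ 0 := fun h0 => by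
      have := χ.map_one
      rw [← mul_inv_cancel κ, map_mul, h0, zero_mul] at this
      exact zero_ne_one this
    rw [map_mul, hχ, pow_succ', C_mul] at h
    refine mul_left_cancel₀ (mul_ne_zero (C_ne_zero.2 hne) hw') ?_
    rw [h]; ring

theorem isUnit_det_map_C {ι σ : Type*} [Fintype ι] [DecidableEq ι] {A : Matrix ι ι ℂ}
    (h : A.det ≠ 0) : IsUnit (A.map (C : ℂ →+* MvPolynomial σ ℂ)).det := by
  rw [show (A.map (C : ℂ →+* MvPolynomial σ ℂ)) = (C : ℂ →+* MvPolynomial σ ℂ).mapMatrix A from rfl,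
    ← RingHom.map_det]
  exact (isUnit_iff_ne_zero.2 h).map C

/-- Weighted sums over the inertia group are divisible by powers of the linear form. -/
theorem pow_dvd_sum_inertia {n : ℕ} {G : Subgroup (GL (Fin n) ℂ)} [Finite G]
    {w : Fin n → ℂ} (hw : w ≠ 0) [Fintype (inertia G (linForm w))]
    {χ : inertia G (linForm w) →* ℂ} (hinj : Function.Injective χ)
    (hχ : ∀ κ : inertia G (linForm w),
      polyActHom ((κ : G) : GL (Fin n) ℂ) (linForm w) = C (χ κ) * linForm w)
    (a : ℕ) (ha : a < Nat.card (inertia G (linForm w))) (f : MvPolynomial (Fin n) ℂ) :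
    linForm w ^ a ∣ ∑ κ : inertia G (linForm w),
      C (χ κ⁻¹ ^ a) * polyActHom ((κ : G) : GL (Fin n) ℂ) f := by
  refine pow_dvd_of_semiinvariant hw hinj hχ a ha _ fun κ' => ?_
  rw [map_sum, Finset.mul_sum]
  refine Fintype.sum_equiv (Equiv.mulLeft κ') _ _ fun κ => ?_
  have hc : χ κ' * χ (κ' * κ)⁻¹ = χ κ⁻¹ := by
    rw [mul_comm, ← map_mul, mul_inv_rev, inv_mul_cancel_right]
  rw [map_mul, ← algebraMap_eq, AlgHom.commutes, algebraMap_eq, ← polyActHom_mul,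
    Equiv.coe_mulLeft, ← mul_assoc, ← C_mul, ← mul_pow, hc]
  rfl

/-- The lower bound for the order of vanishing of `det (ρᵢ q_j)` along a hyperplane. -/
theorem linForm_pow_dvd_det {n : ℕ} {G : Subgroup (GL (Fin n) ℂ)} [Finite G]
    {w : Fin n → ℂ} (hw : w ≠ 0) {d : ℕ} (e : Fin d ≃ G) (q : Fin d → MvPolynomial (Fin n) ℂ) :
    linForm w ^ (d * (Nat.card (inertia G (linForm w)) - 1) / 2) ∣
      (Matrix.of fun i j => polyActHom (e i : GL (Fin n) ℂ) (q j)).det := by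
  obtain ⟨χ, hinj, hχ⟩ := exists_inertia_character (G := G) hw
  obtain ⟨m, hm⟩ : ∃ m, m = Nat.card (inertia G (linForm w)) := ⟨_, rfl⟩
  rw [← hm]
  obtain ⟨T, hT, -⟩ := (inertia G (linForm w)).exists_isComplement_right 1
  have := Fintype.ofFinite T
  have := Fintype.ofFinite (inertia G (linForm w))
  let eK : Fin m ≃ inertia G (linForm w) := (Finite.equivFinOfCardEq hm.symm).symm
  obtain ⟨Φ, hΦ⟩ : ∃ Φ : Fin m × T ≃ Fin d, ∀ x, e (Φ x) = (eK x.1 : G) * (x.2 : G) :=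
    ⟨((eK.prodCongr (Equiv.refl T)).trans (Equiv.ofBijective _ hT)).trans e.symm,
      fun x => e.apply_symm_apply _⟩
  have hd : d = m * Fintype.card T := by
    simpa using (Fintype.card_congr Φ).symm
  let x : Fin m → ℂ := fun b => χ (eK b)⁻¹
  have hx : Function.Injective x := fun b c h => by simpa using hinj h
  let F : Matrix (Fin m × T) (Fin m × T) (MvPolynomial (Fin n) ℂ) :=
    (Matrix.kroneckerMap (· * ·) (Matrix.vandermonde x).transpose (1 : Matrix T T ℂ)).map C
  have hF : IsUnit F.det := by
    refine isUnit_det_map_C ?_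
    rw [Matrix.det_kronecker, Matrix.det_transpose, Matrix.det_one, one_pow, mul_one]
    exact pow_ne_zero _ (Matrix.det_vandermonde_ne_zero_iff.2 hx)
  set M := Matrix.of fun i j => polyActHom (e i : GL (Fin n) ℂ) (q j) with hM
  have hrow : ∀ y j, linForm w ^ (y.1 : ℕ) ∣ (F * M.submatrix Φ Φ) y j := by
    rintro ⟨a, t⟩ j
    have hsum : (F * M.submatrix Φ Φ) (a, t) j = ∑ κ : inertia G (linForm w), C (χ κ⁻¹ ^ (a : ℕ)) *
        polyActHom ((κ : G) : GL (Fin n) ℂ) (polyActHom ((t : G) : GL (Fin n) ℂ) (q (Φ j))) := by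
      rw [Matrix.mul_apply, Fintype.sum_prod_type, ← eK.sum_comp]
      refine Finset.sum_congr rfl fun b _ => ?_
      rw [Finset.sum_eq_single t]
      · simp [F, x, hM, hΦ, polyActHom_mul, Matrix.vandermonde_apply]
      · intro t' _ ht'
        simp [F, Matrix.one_apply_ne ht'.symm]
      · simp
    rw [hsum]
    exact pow_dvd_sum_inertia hw hinj hχ a (a.2.trans_eq hm) _
  choose g hg using hrow
  have hdet : F.det * M.det = (∏ y : Fin m × T, linForm w ^ (y.1 : ℕ)) * (Matrix.of g).det := by
    rw [← Matrix.det_mul_column, ← Matrix.det_submatrix_equiv_self Φ M, ← Matrix.det_mul]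
    congr 1
    ext1 y j
    rw [hg]; rfl
  have hexp : d * (m - 1) / 2 = ∑ y : Fin m × T, (y.1 : ℕ) := by
    rw [Fintype.sum_prod_type]
    simp only [Finset.sum_const, Finset.card_univ, smul_eq_mul]
    rw [← Finset.mul_sum, Fin.sum_univ_eq_sum_range (fun i => i)]
    have := Finset.sum_range_id_mul_two m
    refine Nat.div_eq_of_eq_mul_left two_pos ?_
    rw [mul_assoc, this, hd]; ring
  rw [hexp, ← Finset.prod_pow_eq_pow_sum]
  exact hF.dvd_mul_left.1 ⟨_, hdet⟩

theorem Prime.not_pow_card_filter_dvd_prod {R ι : Type*} [CommRing R] [IsDomain R] {P : R}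
    (hP : Prime P) (s : Finset ι) (f : ι → R) [DecidablePred fun x => P ∣ f x]
    (h : ∀ x ∈ s, ¬ P ^ 2 ∣ f x) :
    ¬ P ^ ((s.filter fun x => P ∣ f x).card + 1) ∣ ∏ x ∈ s, f x := by
  rw [pow_dvd_iff_le_emultiplicity, Finset.emultiplicity_prod hP, not_le]
  have hle : ∑ x ∈ s, emultiplicity P (f x) ≤ ∑ x ∈ s, if P ∣ f x then (1 : ℕ∞) else 0 := by
    refine Finset.sum_le_sum fun x hx => ?_
    split_ifs with hd
    · exact Order.le_of_lt_add_one (emultiplicity_lt_iff_not_dvd.2 (h x hx))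
    · exact (emultiplicity_eq_zero.2 hd).le
  rw [Finset.sum_boole] at hle
  refine hle.trans_lt ?_
  exact_mod_cast Nat.lt_succ_self _

/-- A generic linear form has no accidental congruences between its conjugates modulo finitely
many given polynomials. -/
theorem exists_generic_linForm {n : ℕ} (G : Subgroup (GL (Fin n) ℂ)) [Finite G]
    {ι : Type*} [Finite ι] (P : ι → MvPolynomial (Fin n) ℂ) :
    ∃ u, ∀ k, ∀ σ τ : G, P k ∣ polyActHom (σ : GL (Fin n) ℂ) (linForm u) -
      polyActHom (τ : GL (Fin n) ℂ) (linForm u) → σ * τ⁻¹ ∈ inertia G (P k) := by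
  by_contra! hcon
  let N : {x : ι × G × G // x.2.1 * x.2.2⁻¹ ∉ inertia G (P x.1)} → Subspace ℂ (Fin n → ℂ) :=
    fun x => ((Ideal.span {P x.1.1}).restrictScalars ℂ).comap
      (((polyActHom (x.1.2.1 : GL (Fin n) ℂ)).toLinearMap -
        (polyActHom (x.1.2.2 : GL (Fin n) ℂ)).toLinearMap) ∘ₗ linForm)
  have hN : ∀ x v, v ∈ N x ↔ P x.1.1 ∣ polyActHom (x.1.2.1 : GL (Fin n) ℂ) (linForm v) -
      polyActHom (x.1.2.2 : GL (Fin n) ℂ) (linForm v) := fun x v => by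
    simp [N, Ideal.mem_span_singleton]
  obtain ⟨⟨⟨k, σ, τ⟩, hx⟩, htop⟩ := Subspace.exists_eq_top_of_iUnion_eq_univ (p := N) <| by
    refine Set.eq_univ_of_forall fun u => ?_
    obtain ⟨k, σ, τ, h1, h2⟩ := hcon u
    exact Set.mem_iUnion.2 ⟨⟨⟨k, σ, τ⟩, h2⟩, (hN _ _).2 h1⟩
  refine hx (mem_inertia_of_linForm fun v => ?_)
  have := (hN ⟨⟨k, σ, τ⟩, hx⟩ (Matrix.vecMul v
    (((τ : GL (Fin n) ℂ)⁻¹)⁻¹ : GL (Fin n) ℂ).val)).1 (htop ▸ Submodule.mem_top)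
  rw [← polyActHom_linForm, ← polyActHom_mul, ← polyActHom_mul, mul_inv_cancel,
    polyActHom_one] at this
  exact this

theorem eq_one_of_mem_inertia_zero {n : ℕ} {G : Subgroup (GL (Fin n) ℂ)} {σ : G}
    (h : σ ∈ inertia G 0) : σ = 1 :=
  Subtype.ext <| polyActHom_faithful fun v => by
    rw [Subgroup.coe_one, polyActHom_one]
    exact sub_eq_zero.1 (zero_dvd_iff.1 (h _))

theorem two_mul_card_inertia_pairs_le {Γ : Type*} [Group Γ] [Finite Γ] {d : ℕ} (e : Fin d ≃ Γ)
    (K : Subgroup Γ) (s : Finset (Σ _ : Fin d, Fin d))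
    (hs : ∀ x ∈ s, x.1 < x.2 ∧ e x.2 * (e x.1)⁻¹ ∈ K) :
    2 * s.card ≤ d * (Nat.card K - 1) := by
  classical
  have := Fintype.ofFinite K
  let A : Finset (Fin d × Γ) :=
    Finset.univ ×ˢ ((Finset.univ.image (Subtype.val : K → Γ)).erase 1)
  have hA : A.card = d * (Nat.card K - 1) := by
    rw [Finset.card_product, Finset.card_univ, Fintype.card_fin, Finset.card_erase_of_mem,
      Finset.card_image_of_injective _ Subtype.val_injective, Finset.card_univ,
      Nat.card_eq_fintype_card]
    exact Finset.mem_image.2 ⟨1, Finset.mem_univ _, rfl⟩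
  have hmem : ∀ i j : Fin d, i ≠ j → e j * (e i)⁻¹ ∈ K → (i, e j * (e i)⁻¹) ∈ A := by
    intro i j hij hK
    simp only [A, Finset.mem_product, Finset.mem_univ, true_and, Finset.mem_erase,
      Finset.mem_image, Subtype.exists, exists_prop, exists_eq_right]
    exact ⟨fun h => hij (e.injective (mul_inv_eq_one.1 h)).symm, hK⟩
  let f : (Σ _ : Fin d, Fin d) ⊕ (Σ _ : Fin d, Fin d) → Fin d × Γ :=
    Sum.elim (fun x => (x.1, e x.2 * (e x.1)⁻¹)) (fun x => (x.2, e x.1 * (e x.2)⁻¹))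
  rw [← hA, two_mul, ← Finset.card_disjSum]
  refine Finset.card_le_card_of_injOn f ?_ ?_
  · rintro (x | x) hx
    · have hx' := hs x (by simpa using hx)
      exact hmem _ _ hx'.1.ne hx'.2
    · have hx' := hs x (by simpa using hx)
      refine hmem _ _ hx'.1.ne' ?_
      have := K.inv_mem hx'.2
      rwa [mul_inv_rev, inv_inv] at this
  · rintro (⟨i, j⟩ | ⟨i, j⟩) hx (⟨i', j'⟩ | ⟨i', j'⟩) hy hxy
    all_goals
      have hx' := hs ⟨_, _⟩ (by simpa using hx)
      have hy' := hs ⟨_, _⟩ (by simpa using hy)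
      simp only [f, Sum.elim_inl, Sum.elim_inr, Prod.mk.injEq] at hxy
      obtain ⟨rfl, h2⟩ := hxy
      obtain rfl := e.injective (mul_right_cancel h2)
    · rfl
    · exact absurd hx'.1 hy'.1.asymm
    · exact absurd hx'.1 hy'.1.asymm
    · rfl

theorem det_polyActHom_dvd {n : ℕ} {G : Subgroup (GL (Fin n) ℂ)} {d : ℕ} (e : Fin d ≃ G)
    {p : Fin d → MvPolynomial (Fin n) ℂ}
    (hp : ∀ q : MvPolynomial (Fin n) ℂ, ∃ r : Fin d → MvPolynomial (Fin n) ℂ,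
      (∀ i, ∀ σ ∈ G, polyActHom σ (r i) = r i) ∧ q = ∑ i, r i * p i)
    (q : Fin d → MvPolynomial (Fin n) ℂ) :
    (Matrix.of fun i j => polyActHom (e i : GL (Fin n) ℂ) (p j)).det ∣
      (Matrix.of fun i j => polyActHom (e i : GL (Fin n) ℂ) (q j)).det := by
  choose r hr hq using fun j => hp (q j)
  refine ⟨(Matrix.of fun k j => r j k).det, ?_⟩
  rw [← Matrix.det_mul]
  congr 1
  ext1 i j
  rw [Matrix.of_apply, Matrix.mul_apply]
  conv_lhs => rw [hq j]
  rw [map_sum]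
  refine Finset.sum_congr rfl fun k _ => ?_
  rw [map_mul, hr j k _ (e i).2, mul_comm]
  rfl

theorem det_polyActHom_pow {n d : ℕ} (g : Fin d → GL (Fin n) ℂ) (q : MvPolynomial (Fin n) ℂ) :
    (Matrix.of fun i j : Fin d => polyActHom (g i) (q ^ (j : ℕ))).det =
      (Matrix.vandermonde fun i => polyActHom (g i) q).det := by
  congr 1
  ext1 i j
  rw [Matrix.of_apply, map_pow, Matrix.vandermonde_apply]

theorem det_polyActHom_ne_zero {n : ℕ} {G : Subgroup (GL (Fin n) ℂ)} [Finite G] {d : ℕ}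
    (e : Fin d ≃ G) {p : Fin d → MvPolynomial (Fin n) ℂ}
    (hp : ∀ q : MvPolynomial (Fin n) ℂ, ∃ r : Fin d → MvPolynomial (Fin n) ℂ,
      (∀ i, ∀ σ ∈ G, polyActHom σ (r i) = r i) ∧ q = ∑ i, r i * p i) :
    (Matrix.of fun i j => polyActHom (e i : GL (Fin n) ℂ) (p j)).det ≠ 0 := by
  intro h0
  obtain ⟨u, hu⟩ := exists_generic_linForm G (fun _ : Unit => 0)
  have h1 := det_polyActHom_dvd e hp fun j => linForm u ^ (j : ℕ)
  rw [h0, zero_dvd_iff, det_polyActHom_pow] at h1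
  refine Matrix.det_vandermonde_ne_zero_iff.2 (fun i j hij => e.injective ?_) h1
  exact mul_inv_eq_one.1 <|
    eq_one_of_mem_inertia_zero (hu () _ _ (zero_dvd_iff.2 (sub_eq_zero.2 hij)))

/-- The upper bound for the multiplicity of an irreducible polynomial in `det Λ`. -/
theorem not_pow_dvd_det {n : ℕ} {G : Subgroup (GL (Fin n) ℂ)} [Finite G] {d : ℕ}
    (e : Fin d ≃ G) {p : Fin d → MvPolynomial (Fin n) ℂ}
    (hp : ∀ q : MvPolynomial (Fin n) ℂ, ∃ r : Fin d → MvPolynomial (Fin n) ℂ,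
      (∀ i, ∀ σ ∈ G, polyActHom σ (r i) = r i) ∧ q = ∑ i, r i * p i)
    {P : MvPolynomial (Fin n) ℂ} (hP : Irreducible P) :
    ¬ P ^ (d * (Nat.card (inertia G P) - 1) / 2 + 1) ∣
      (Matrix.of fun i j => polyActHom (e i : GL (Fin n) ℂ) (p j)).det := by
  classical
  intro hdvd
  obtain ⟨u, hu⟩ := exists_generic_linForm G (fun b : Bool => if b then P else 0)
  have hP' := hu true
  have h0 := hu false
  simp only [if_true, Bool.false_eq_true, if_false, zero_dvd_iff] at hP' h0
  have h1 := hdvd.trans (det_polyActHom_dvd e hp fun j => linForm u ^ (j : ℕ))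
  rw [det_polyActHom_pow, Matrix.det_vandermonde, Finset.prod_sigma'] at h1
  refine hP.prime.not_pow_card_filter_dvd_prod _ _ (fun x hx => ?_)
    ((pow_dvd_pow _ (Nat.succ_le_succ ?_)).trans h1)
  · have hlt : x.1 < x.2 := by simpa using hx
    have hne : polyActHom (e x.2 : GL (Fin n) ℂ) (linForm u) -
        polyActHom (e x.1 : GL (Fin n) ℂ) (linForm u) ≠ 0 := fun h => by
      have := eq_one_of_mem_inertia_zero (h0 _ _ h)
      exact hlt.ne' (e.injective (mul_inv_eq_one.1 this))
    simp only [polyActHom_linForm, ← map_sub] at hne ⊢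
    exact hP.not_sq_dvd_linForm hne
  · rw [Nat.le_div_iff_mul_le two_pos, mul_comm]
    refine two_mul_card_inertia_pairs_le e _ _ fun x hx => ?_
    rw [Finset.mem_filter] at hx
    exact ⟨by simpa using hx.1, hP' _ _ hx.2⟩

/-- A nontrivial inertia group of an irreducible polynomial comes from a pseudoreflection. -/
theorem exists_pseudoreflection_of_inertia_ne_bot {n : ℕ} {G : Subgroup (GL (Fin n) ℂ)} [Finite G]
    {P : MvPolynomial (Fin n) ℂ} (hP : Irreducible P) (hne : inertia G P ≠ ⊥) :
    ∃ τ ∈ G, IsPseudoreflection τ ∧ ∃ w, Associated P (linForm w) ∧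
      {z | gAct τ z = z} = {z | eval z (linForm w) = 0} := by
  obtain ⟨⟨τ, hτ⟩, hτne⟩ := Subgroup.ne_bot_iff_exists_ne_one.1 hne
  have hτ1 : τ ≠ 1 := fun h => hτne (Subtype.ext h)
  obtain ⟨v, hv⟩ : ∃ v, polyActHom (τ : GL (Fin n) ℂ) (linForm v) - linForm v ≠ 0 := by
    by_contra! h
    refine hτ1 (Subtype.ext (polyActHom_faithful fun v => ?_))
    rw [Subgroup.coe_one, polyActHom_one]
    exact sub_eq_zero.1 (h v)
  have hPv := hτ (linForm v)
  rw [polyActHom_linForm, ← map_sub] at hPv hv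
  have hass := hP.associated_of_dvd (irreducible_linForm hv) hPv
  generalize Matrix.vecMul v _ - v = w at hv hass
  have hw : w ≠ 0 := fun h => hv (by rw [h, map_zero])
  rw [inertia_eq_of_associated hass] at hτ
  have hfix := (mem_inertia_linForm_iff hw).1 hτ
  obtain ⟨k, hk⟩ := Function.ne_iff.1 hw
  rw [Pi.zero_apply] at hk
  set A : Matrix (Fin n) (Fin n) ℂ :=
    1 - ((τ : GL (Fin n) ℂ) : Matrix (Fin n) (Fin n) ℂ) with hA
  have hAz : ∀ z, A.mulVec z = z - gAct (τ : GL (Fin n) ℂ) z := fun z => by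
    rw [hA, Matrix.sub_mulVec, Matrix.one_mulVec]; rfl
  let a : Fin n → ℂ := (w k)⁻¹ • A.mulVec (Pi.single k 1)
  have hAw : ∀ z, A.mulVec z = (w ⬝ᵥ z) • a := fun z => by
    have h := hfix (z - ((w k)⁻¹ * (w ⬝ᵥ z)) • Pi.single k 1) (by
      rw [eval_linForm, dotProduct_sub, dotProduct_smul, dotProduct_single, smul_eq_mul]
      field_simp
      ring)
    rw [eq_comm, ← sub_eq_zero, ← hAz, Matrix.mulVec_sub, Matrix.mulVec_smul, sub_eq_zero] at h
    rw [h, mul_comm, mul_smul]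
  have hA0 : A ≠ 0 := fun h => hτ1 (Subtype.ext (Units.ext (sub_eq_zero.1 h).symm))
  have ha : a ≠ 0 := fun h => hA0 (Matrix.ext_of_mulVec_single fun i => by
    rw [hAw, h, smul_zero, Matrix.zero_mulVec])
  refine ⟨(τ : GL (Fin n) ℂ), τ.2, ⟨?_, ?_⟩, w, hass, ?_⟩
  · exact G.subtype.isOfFinOrder (isOfFinOrder_of_finite τ)
  · have hvec : A = Matrix.vecMulVec a w := Matrix.ext_of_mulVec_single fun i => by
      rw [hAw, Matrix.vecMulVec_mulVec]; simp
    have hrank : A.rank ≠ 0 := fun h => hA0 <| Matrix.ext_of_mulVec_single fun i => by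
      have := LinearMap.range_eq_bot.1 (Submodule.finrank_eq_zero.1 h)
      rw [Matrix.zero_mulVec]
      exact LinearMap.congr_fun this _
    refine le_antisymm ?_ (Nat.one_le_iff_ne_zero.2 hrank)
    rw [← hA, hvec]
    exact Matrix.rank_vecMulVec_le _ _
  · ext z
    rw [Set.mem_ofPred_eq, Set.mem_ofPred_eq, eval_linForm, eq_comm, ← sub_eq_zero, ← hAz, hAw,
      smul_eq_zero, or_iff_left ha]

theorem associated_linForm_of_ker_eq {n : ℕ} {w w' : Fin n → ℂ} (hw : w ≠ 0) (hw' : w' ≠ 0)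
    (h : {z | eval z (linForm w) = 0} = {z | eval z (linForm w') = 0}) :
    Associated (linForm w) (linForm w') := by
  have hne := (map_ne_zero_iff linForm linForm_injective).2 hw
  have hne' := (map_ne_zero_iff linForm linForm_injective).2 hw'
  refine (irreducible_linForm hne).associated_of_dvd (irreducible_linForm hne')
    (linForm_dvd_of_ker_le hw fun z hz => ?_)
  rw [← eval_linForm] at hz ⊢
  exact (Set.ext_iff.1 h z).1 hz

/-- **Determinant formula.** For a finite pseudoreflection group `G` of order `d` with
distinct reflecting hyperplanes `H₁,…,H_r` (cut out by linear forms `L₁,…,L_r`, with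
`m_i` the order of the cyclic subgroup of `G` fixing `H_i` pointwise) and a basis
`p₁,…,p_d` of `ℂ[z]` over `ℂ[z]^G`, one has `det Λ = c·∏ᵢ Lᵢ^{d(mᵢ−1)/2}` for a nonzero
constant `c`, where `Λ = ((ρᵢ·p_j))`. -/
theorem det_Lambda_formula {n : ℕ} (G : Subgroup (GL (Fin n) ℂ)) [Finite G]
    (hG : IsPseudoreflectionGroup G) (d : ℕ) (e : Fin d ≃ G)
    (p : Fin d → MvPolynomial (Fin n) ℂ)
    (hbasis_ex : ∀ q : MvPolynomial (Fin n) ℂ, ∃ r : Fin d → MvPolynomial (Fin n) ℂ,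
      (∀ i, ∀ σ ∈ G, polyAct σ (r i) = r i) ∧ q = ∑ i, r i * p i)
    (hbasis_uniq : ∀ r r' : Fin d → MvPolynomial (Fin n) ℂ,
      (∀ i, ∀ σ ∈ G, polyAct σ (r i) = r i) → (∀ i, ∀ σ ∈ G, polyAct σ (r' i) = r' i) →
      ∑ i, r i * p i = ∑ i, r' i * p i → r = r')
    (r : ℕ) (H : Fin r → Set (Fin n → ℂ)) (hHdist : Function.Injective H)
    (hHrefl : ∀ i, ∃ σ ∈ G, IsPseudoreflection σ ∧ H i = {z : Fin n → ℂ | gAct σ z = z})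
    (hHall : ∀ σ ∈ G, IsPseudoreflection σ →
      ∃ i, H i = {z : Fin n → ℂ | gAct σ z = z})
    (L : Fin r → MvPolynomial (Fin n) ℂ) (hL0 : ∀ i, L i ≠ 0)
    (hLhom : ∀ i, (L i).IsHomogeneous 1)
    (hLker : ∀ i, H i = {z : Fin n → ℂ | MvPolynomial.eval z (L i) = 0})
    (m : Fin r → ℕ)
    (hm : ∀ i, m i = Set.ncard {σ : GL (Fin n) ℂ | σ ∈ G ∧ ∀ z ∈ H i, gAct σ z = z}) :
    ∃ c : ℂ, c ≠ 0 ∧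
      Matrix.det (Matrix.of fun i j : Fin d => polyAct (↑(e i) : GL (Fin n) ℂ) (p j)) =
        MvPolynomial.C c * ∏ i, (L i) ^ (d * (m i - 1) / 2) := by
  choose w hw using fun i => exists_eq_linForm (hLhom i)
  obtain rfl : L = fun i => linForm (w i) := funext hw
  beta_reduce at hL0 hLker
  have hw0 : ∀ i, w i ≠ 0 := fun i h => hL0 i (by simp only [h, map_zero])
  have hirr : ∀ i, Irreducible (linForm (w i)) := fun i => irreducible_linForm (hL0 i)
  have hm' : ∀ i, m i = Nat.card (inertia G (linForm (w i))) := fun i => by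
    rw [hm i, ← Nat.card_coe_set_eq]
    refine Nat.card_congr
      { toFun := fun σ => ⟨⟨σ.1, σ.2.1⟩, (mem_inertia_linForm_iff (hw0 i)).2 fun z hz =>
          σ.2.2 z ((hLker i).symm.subset hz)⟩
        invFun := fun σ => ⟨σ.1.1, σ.1.2, fun z hz =>
          (mem_inertia_linForm_iff (hw0 i)).1 σ.2 z ((hLker i).subset hz)⟩ }
  simp only [polyAct_eq_polyActHom] at hbasis_ex ⊢
  obtain ⟨Q, hQ⟩ : ∏ i, linForm (w i) ^ (d * (m i - 1) / 2) ∣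
      (Matrix.of fun i j => polyActHom (e i : GL (Fin n) ℂ) (p j)).det := by
    refine Fintype.prod_dvd_of_isRelPrime (fun i j hij => ?_) fun i => ?_
    · refine IsRelPrime.pow ((hirr i).isRelPrime_iff_not_dvd.2 fun h => hij (hHdist ?_))
      obtain ⟨c, hc⟩ := eq_smul_of_linForm_dvd (hw0 i) h
      have hc0 : c ≠ 0 := fun h0 => hw0 j (by rw [hc, h0, zero_smul])
      rw [hLker i, hLker j, hc]
      ext z
      simp [eval_linForm, hc0]
    · rw [hm' i]
      exact linForm_pow_dvd_det (hw0 i) e p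
  have hQu : IsUnit Q := by
    by_contra hQu
    have hQ0 : Q ≠ 0 := by
      rintro rfl
      exact det_polyActHom_ne_zero e hbasis_ex (by rw [hQ, mul_zero])
    obtain ⟨P, hP, hPQ⟩ := WfDvdMonoid.exists_irreducible_factor hQu hQ0
    have hup := not_pow_dvd_det e hbasis_ex hP
    by_cases hbot : inertia G P = ⊥
    · refine hup ?_
      rw [hbot, Subgroup.card_bot, hQ, Nat.sub_self, mul_zero, Nat.zero_div, zero_add, pow_one]
      exact hPQ.mul_left _
    · obtain ⟨τ, hτG, hτ, v, hPv, hker⟩ := exists_pseudoreflection_of_inertia_ne_bot hP hbot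
      obtain ⟨i, hi⟩ := hHall τ hτG hτ
      have hv : v ≠ 0 := by
        rintro rfl
        rw [map_zero, associated_zero_iff_eq_zero] at hPv
        exact hP.ne_zero hPv
      have hass := hPv.trans (associated_linForm_of_ker_eq hv (hw0 i)
        (hker.symm.trans (hi.symm.trans (hLker i))))
      refine hup ?_
      rw [inertia_eq_of_associated hass, hQ, ← hm' i, pow_succ]
      exact mul_dvd_mul ((hass.pow_pow.dvd).trans
        (Finset.dvd_prod_of_mem _ (Finset.mem_univ i))) hPQ
  obtain ⟨c, hc, rfl⟩ := isUnit_iff_eq_C_of_isReduced.1 hQu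
  exact ⟨c, hc.ne_zero, by rw [hQ, mul_comm]⟩
end
end

section
/- Let f : ℂⁿ → ℂ be an entire function and, for each k ≥ 0, let f₍ₖ₎ denote the degree-k homogeneous component of the power series expansion of f at the origin (so f(z) = Σ_{k≥0} f₍ₖ₎(z), converging locally uniformly). Let 𝔭 ∈ ℂ[z₁,…,zₙ] be a finite product of nonzero homogeneous linear polynomials. If 𝔭 divides f₍ₖ₎ in ℂ[z₁,…,zₙ] for every k, then there exists an entire function h : ℂⁿ → ℂ with f(z) = 𝔭(z)·h(z) for all z ∈ ℂⁿ. -/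
open MvPolynomial

noncomputable section

open Metric in
/-- Cauchy estimates for the homogeneous components of an entire function, uniformly on a
compact set. -/
theorem exists_norm_eval_le_of_hasSum_homogeneous {n : ℕ}
    {f : (Fin n → ℂ) → ℂ} (hf : Differentiable ℂ f)
    {P : ℕ → MvPolynomial (Fin n) ℂ} (hPhom : ∀ k, (P k).IsHomogeneous k)
    (hPsum : ∀ z : Fin n → ℂ, HasSum (fun k => MvPolynomial.eval z (P k)) (f z))
    {K : Set (Fin n → ℂ)} (hK : IsCompact K) :
    ∃ C : ℝ, ∀ k, ∀ z ∈ K, ‖MvPolynomial.eval z (P k)‖ ≤ C * (1 / 2) ^ k := by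
  obtain ⟨C, hC⟩ := ((isCompact_closedBall (0 : ℂ) 2).prod hK).exists_bound_of_continuousOn
    (f := fun x : ℂ × (Fin n → ℂ) => f (x.1 • x.2)) (by
      have := hf.continuous
      fun_prop)
  refine ⟨C, fun k z hz => ?_⟩
  set g : ℂ → ℂ := fun w => f (w • z) with hg
  have hgd : Differentiable ℂ g := by fun_prop
  have hsmul (w : ℂ) (j : ℕ) : eval (w • z) (P j) = w ^ j * eval z (P j) := by
    rw [eval_eq, eval_eq, Finset.mul_sum]
    refine Finset.sum_congr rfl fun d hd => ?_
    have hdeg : ∑ i, d i = j := by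
      rw [← (hPhom j) (mem_support_iff.mp hd), Finsupp.weight_apply,
        Finsupp.sum_fintype _ _ (by simp)]
      simp
    have hsub : ∏ i ∈ d.support, w ^ d i = w ^ j := by
      rw [Finset.prod_pow_eq_pow_sum, ← hdeg]
      congr 1
      exact Finset.sum_subset (Finset.subset_univ _) (by simp)
    simp only [Pi.smul_apply, smul_eq_mul, mul_pow, Finset.prod_mul_distrib, hsub]
    ring
  have hps : HasFPowerSeriesAt g
      (FormalMultilinearSeries.ofScalars ℂ fun j => eval z (P j)) 0 := by
    rw [hasFPowerSeriesAt_iff]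
    refine Filter.Eventually.of_forall fun w => ?_
    simpa [FormalMultilinearSeries.coeff_ofScalars, hg, hsmul] using hPsum (w • z)
  have hcoeff : eval z (P k) = iteratedDeriv k g 0 / k.factorial := by
    have := (hps.eq_formalMultilinearSeries (hgd.analyticAt 0).hasFPowerSeriesAt)
    simpa [FormalMultilinearSeries.coeff_ofScalars] using
      congrArg (fun q => FormalMultilinearSeries.coeff q k) this
  have hbound := Complex.norm_iteratedDeriv_le_of_forall_mem_sphere_norm_le (f := g) (c := 0) k
    two_pos hgd.diffContOnCl (C := C) fun w hw => hC (w, z) ⟨sphere_subset_closedBall hw, hz⟩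
  rw [hcoeff, norm_div, Complex.norm_natCast, div_le_iff₀ (by positivity)]
  refine hbound.trans_eq ?_
  rw [one_div, inv_pow]
  ring

open Metric Topology in
/-- Near any point, a polynomial `Q` is controlled by the values of `p * Q` on a compact set
depending only on `p` and the point. -/
theorem MvPolynomial.exists_norm_eval_le_of_norm_eval_mul_le {n : ℕ}
    {p : MvPolynomial (Fin n) ℂ} (hp : p ≠ 0) (z₀ : Fin n → ℂ) :
    ∃ ε > 0, ∃ K : Set (Fin n → ℂ), IsCompact K ∧ ∃ c > 0,
      ∀ (Q : MvPolynomial (Fin n) ℂ) (M : ℝ), (∀ z ∈ K, ‖eval z (p * Q)‖ ≤ M) →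
        ∀ z ∈ ball z₀ ε, ‖eval z Q‖ ≤ M / c := by
  obtain ⟨u, hu⟩ : ∃ u, eval u p ≠ 0 := by
    by_contra! h
    exact hp (MvPolynomial.funext fun x => by simp [h x])
  set v := u - z₀ with hv
  let q : Polynomial ℂ :=
    aeval (fun i => Polynomial.C (z₀ i) + Polynomial.X * Polynomial.C (v i)) p
  have hq (w : ℂ) : q.eval w = eval (z₀ + w • v) p := by
    have := MvPolynomial.comp_aeval_apply (R := ℂ)
      (fun i => Polynomial.C (z₀ i) + Polynomial.X * Polynomial.C (v i)) (Polynomial.aeval w) p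
    rw [Polynomial.coe_aeval_eq_eval] at this
    rw [this, ← MvPolynomial.coe_aeval_eq_eval]
    simp only [RingHom.coe_coe]
    congr 2
    ext i
    simp only [Polynomial.eval_add, Polynomial.eval_mul, Polynomial.eval_C, Polynomial.eval_X,
      Pi.add_apply, Pi.smul_apply, smul_eq_mul]
  have hq0 : q ≠ 0 := by
    intro h
    apply hu
    have := hq 1
    simpa [h, hv] using this.symm
  obtain ⟨ρ, hρ, hρq⟩ := (Set.Ioi_infinite (0 : ℝ)).exists_notMem_finset
    (q.roots.toFinset.image norm)
  have hne : ∀ w ∈ sphere (0 : ℂ) ρ, eval (z₀ + w • v) p ≠ 0 := by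
    intro w hw h
    apply hρq
    rw [Finset.mem_image]
    exact ⟨w, by simpa [hq0, hq] using h, by simpa using hw⟩
  have hcont (r : MvPolynomial (Fin n) ℂ) :
      Continuous fun x : (Fin n → ℂ) × ℂ => eval (x.1 + x.2 • v) r :=
    (MvPolynomial.continuous_eval r).comp (by fun_prop)
  obtain ⟨c, hc, hcb⟩ := (isCompact_sphere (0 : ℂ) ρ).exists_forall_le'
    (f := fun w => ‖eval (z₀ + w • v) p‖) (a := 0)
    (((hcont p).comp (Continuous.prodMk_right z₀)).norm.continuousOn)
    fun w hw => norm_pos_iff.mpr (hne w hw)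
  have hev : ∀ᶠ z in 𝓝 z₀, ∀ w ∈ sphere (0 : ℂ) ρ, c / 2 < ‖eval (z + w • v) p‖ := by
    refine (isCompact_sphere (0 : ℂ) ρ).eventually_forall_of_forall_eventually fun w hw => ?_
    exact (hcont p).norm.continuousAt.eventually_const_lt ((half_lt_self hc).trans_le (hcb w hw))
  obtain ⟨ε, hε, hball⟩ := Metric.eventually_nhds_iff_ball.mp hev
  refine ⟨ε, hε, (fun x : (Fin n → ℂ) × ℂ => x.1 + x.2 • v) '' (closedBall z₀ ε ×ˢ sphere 0 ρ),
    ((isCompact_closedBall z₀ ε).prod (isCompact_sphere 0 ρ)).image (by fun_prop),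
    c / 2, half_pos hc, fun Q M hM z hz => ?_⟩
  have hdiff : Differentiable ℂ fun w : ℂ => eval (z + w • v) Q := by
    have hQ : Differentiable ℂ fun x => eval x Q := fun x =>
      (AnalyticOnNhd.eval_mvPolynomial Q x (Set.mem_univ x)).differentiableAt
    exact hQ.comp (by fun_prop)
  have := Complex.norm_iteratedDeriv_le_of_forall_mem_sphere_norm_le 0 hρ
    (c := 0) hdiff.diffContOnCl (C := M / (c / 2)) fun w hw => by
      have hle := hM _ ⟨(z, w), ⟨ball_subset_closedBall hz, hw⟩, rfl⟩
      rw [map_mul, norm_mul] at hle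
      rw [le_div_iff₀' (half_pos hc)]
      exact (mul_le_mul_of_nonneg_right (hball z hz w hw).le (norm_nonneg _)).trans hle
  simpa using this

open Metric in
/-- A series of entire functions on a complex normed space that is locally dominated by a summable
series is entire. -/
theorem differentiable_tsum_of_locally_summable_norm {E : Type*} [NormedAddCommGroup E]
    [NormedSpace ℂ E] {g : ℕ → E → ℂ} (hg : ∀ k, Differentiable ℂ (g k))
    (hbound : ∀ z₀, ∃ ε > 0, ∃ u : ℕ → ℝ, Summable u ∧ ∀ k, ∀ z ∈ ball z₀ ε, ‖g k z‖ ≤ u k) :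
    Differentiable ℂ fun z => ∑' k, g k z := by
  intro z₀
  obtain ⟨ε, hε, u, hu, hub⟩ := hbound z₀
  have hderiv : ∀ k, ∀ z ∈ ball z₀ (ε / 2), ‖fderiv ℂ (g k) z‖ ≤ 2 * u k / (ε / 2) := by
    intro k z hz
    have hsub : ball z (ε / 2) ⊆ ball z₀ ε :=
      ball_subset_ball' (by linarith [mem_ball.mp hz])
    refine Complex.norm_fderiv_le_div_of_mapsTo_ball (hg k).differentiableOn ?_ (half_pos hε)
    intro y hy
    rw [mem_closedBall, dist_eq_norm]
    have h₁ := hub k y (hsub hy)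
    have h₂ := hub k z (hsub (mem_ball_self (half_pos hε)))
    linarith [norm_sub_le (g k y) (g k z)]
  let : NormedSpace ℝ E := NormedSpace.restrictScalars ℝ ℂ E
  exact (hasFDerivAt_tsum_of_isPreconnected ((hu.mul_left 2).div_const _) isOpen_ball
    (convex_ball z₀ (ε / 2)).isPreconnected (fun k z _ => (hg k z).hasFDerivAt) hderiv
    (mem_ball_self (half_pos hε))
    (.of_norm_bounded hu fun k => hub k z₀ (mem_ball_self hε))
    (mem_ball_self (half_pos hε))).differentiableAt

/-- If `𝔭` is a finite product of nonzero homogeneous linear polynomials dividing every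
homogeneous component of (the power series expansion at the origin of) an entire function
`f : ℂⁿ → ℂ`, then `𝔭` divides `f`: there is an entire `h` with `f = 𝔭·h`. -/
theorem product_of_linear_divides_entire {n N : ℕ}
    (f : (Fin n → ℂ) → ℂ) (hf : Differentiable ℂ f)
    (P : ℕ → MvPolynomial (Fin n) ℂ) (hPhom : ∀ k, (P k).IsHomogeneous k)
    (hPsum : ∀ z : Fin n → ℂ, HasSum (fun k => MvPolynomial.eval z (P k)) (f z))
    (ℓ : Fin N → MvPolynomial (Fin n) ℂ) (hℓ0 : ∀ i, ℓ i ≠ 0)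
    (hℓhom : ∀ i, (ℓ i).IsHomogeneous 1)
    (hdiv : ∀ k, (∏ i, ℓ i) ∣ P k) :
    ∃ h : (Fin n → ℂ) → ℂ, Differentiable ℂ h ∧
      ∀ z : Fin n → ℂ, f z = MvPolynomial.eval z (∏ i, ℓ i) * h z := by
  choose Q hQ using hdiv
  have hp : ∏ i, ℓ i ≠ 0 := Finset.prod_ne_zero_iff.mpr fun i _ => hℓ0 i
  refine ⟨fun z => ∑' k, eval z (Q k), ?_, fun z => ?_⟩
  · refine differentiable_tsum_of_locally_summable_norm
      (fun k z => (AnalyticOnNhd.eval_mvPolynomial (Q k) z (Set.mem_univ z)).differentiableAt)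
      fun z₀ => ?_
    obtain ⟨ε, hε, K, hK, c, -, hc⟩ := exists_norm_eval_le_of_norm_eval_mul_le hp z₀
    obtain ⟨C, hC⟩ := exists_norm_eval_le_of_hasSum_homogeneous hf hPhom hPsum hK
    exact ⟨ε, hε, fun k => C * (1 / 2) ^ k / c, (summable_geometric_two.mul_left C).div_const c,
      fun k => hc (Q k) _ fun z hz => hQ k ▸ hC k z hz⟩
  · rw [← (hPsum z).tsum_eq, ← tsum_mul_left]
    simp only [hQ, map_mul]
end
end

section
/- Let G be a finite pseudoreflection subgroup of GL(n,ℂ) with homogeneous system of parameters θ₁,…,θₙ and associated polynomial map θ : ℂⁿ → ℂⁿ, and let Ω ⊆ ℂⁿ be a G-invariant domain. If f : Ω → ℂ is holomorphic and G-invariant (f(σz) = f(z) for all σ ∈ G, z ∈ Ω), then there exists a function g : θ(Ω) → ℂ, holomorphic on the image θ(Ω), such that f(z) = g(θ(z)) for all z ∈ Ω, and g is unique: any two such functions agree on θ(Ω). -/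
open MvPolynomial

noncomputable section

section Analytic

open Metric Filter Set
open scoped Topology

lemma analyticAt_eval {n : ℕ} (p : MvPolynomial (Fin n) ℂ) (z : Fin n → ℂ) :
    AnalyticAt ℂ (fun x => eval x p) z :=
  AnalyticOnNhd.eval_mvPolynomial p z (mem_univ z)

/-- A polynomial that does not vanish identically on a line has finitely many zeros on it. -/
lemma finite_zeros_on_line {n : ℕ} (D : MvPolynomial (Fin n) ℂ) (a v : Fin n → ℂ) (t₀ : ℂ)
    (h : eval (a + t₀ • v) D ≠ 0) : {t : ℂ | eval (a + t • v) D = 0}.Finite := by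
  let P : Polynomial ℂ := aeval (fun i => Polynomial.C (a i) + Polynomial.X * Polynomial.C (v i)) D
  have hP : ∀ t : ℂ, P.eval t = eval (a + t • v) D := by
    intro t
    have : (Polynomial.aeval t).comp
        (aeval (fun i => Polynomial.C (a i) + Polynomial.X * Polynomial.C (v i)) :
          MvPolynomial (Fin n) ℂ →ₐ[ℂ] Polynomial ℂ) = aeval (a + t • v) := by
      ext i
      simp
      ring
    simpa [P, MvPolynomial.coe_aeval_eq_eval, Polynomial.coe_aeval_eq_eval] using
      DFunLike.congr_fun this D
  have hP0 : P ≠ 0 := by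
    intro h0
    apply h
    rw [← hP, h0, Polynomial.eval_zero]
  refine (P.roots.toFinset.finite_toSet).subset fun t ht => ?_
  have ht' : eval (a + t • v) D = 0 := ht
  simp [hP0, Polynomial.IsRoot, hP, ht']

/-- Riemann's extension theorem for continuous functions across the zero set of a polynomial. -/
lemma differentiableAt_of_continuousOn_off_zeros {n : ℕ} {U : Set (Fin n → ℂ)} (hU : IsOpen U)
    {g : (Fin n → ℂ) → ℂ} (hg : ContinuousOn g U) {D : MvPolynomial (Fin n) ℂ} (hD : D ≠ 0)
    (hd : ∀ y ∈ U, eval y D ≠ 0 → DifferentiableAt ℂ g y) {p : Fin n → ℂ} (hp : p ∈ U) :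
    DifferentiableAt ℂ g p := by
  obtain ⟨w, hw⟩ : ∃ w, eval w D ≠ 0 := by
    by_contra! h
    exact hD (MvPolynomial.funext fun x => by simpa using h x)
  set v := w - p with hv
  have hfin : {t : ℂ | eval (p + t • v) D = 0}.Finite :=
    finite_zeros_on_line D p v 1 (by simpa [hv] using hw)
  have hline : Continuous fun t : ℂ => p + t • v := by fun_prop
  obtain ⟨r, hr, hrU, hrD⟩ : ∃ r > 0, (∀ t ∈ closedBall (0 : ℂ) r, p + t • v ∈ U) ∧
      ∀ t ∈ sphere (0 : ℂ) r, eval (p + t • v) D ≠ 0 := by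
    have h1 : ∀ᶠ t in 𝓝 (0 : ℂ), p + t • v ∈ U :=
      hline.continuousAt.preimage_mem_nhds (hU.mem_nhds (by simpa using hp))
    have h2 : ∀ᶠ t in 𝓝 (0 : ℂ), t ≠ 0 → eval (p + t • v) D ≠ 0 := by
      have : (({t : ℂ | eval (p + t • v) D = 0} \ {0})ᶜ) ∈ 𝓝 (0 : ℂ) :=
        (hfin.sdiff).isClosed.isOpen_compl.mem_nhds (by simp)
      filter_upwards [this] with t ht ht0 h
      exact ht ⟨h, ht0⟩
    obtain ⟨r, hr, h⟩ := nhds_basis_closedBall.eventually_iff.1 (h1.and h2)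
    refine ⟨r, hr, fun t ht => (h ht).1, fun t ht => (h (sphere_subset_closedBall ht)).2 ?_⟩
    rintro rfl
    simp at ht
    exact hr.ne ht
  obtain ⟨ε, hε, hεU⟩ := ((isCompact_closedBall (0 : ℂ) r).image hline).exists_cthickening_subset_open
    hU (by rintro _ ⟨t, ht, rfl⟩; exact hrU t ht)
  have hWo : IsOpen (U ∩ {y | eval y D ≠ 0}) :=
    hU.inter (isOpen_ne_fun (continuous_eval D) continuous_const)
  have hK := (isCompact_sphere (0 : ℂ) r).image hline
  obtain ⟨δ, hδ, hδW⟩ := hK.exists_cthickening_subset_open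
    hWo (by
      rintro _ ⟨t, ht, rfl⟩
      exact ⟨hrU t (sphere_subset_closedBall ht), hrD t ht⟩)
  obtain ⟨M, hM⟩ := (hK.cthickening (r := δ)).exists_bound_of_continuousOn
    (hg.mono fun x hx => (hδW hx).1)
  have hcirc : ∀ θ : ℝ, circleMap 0 r θ ∈ sphere (0 : ℂ) r := circleMap_mem_sphere 0 hr.le
  set s := ball p (min (δ / 2) ε) with hs
  have hs0 : 0 < min (δ / 2) ε := by positivity
  have hsε : ∀ x ∈ s, ∀ t ∈ closedBall (0 : ℂ) r, x + t • v ∈ U := by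
    intro x hx t ht
    refine hεU (mem_cthickening_of_dist_le _ (p + t • v) _ _ ⟨t, ht, rfl⟩ ?_)
    rw [dist_add_right]
    exact ((mem_ball.1 hx).le.trans (min_le_right _ _))
  have hsδ : ∀ x ∈ s, ∀ t ∈ sphere (0 : ℂ) r,
      ball (x + t • v) (δ / 2) ⊆ cthickening δ ((fun t : ℂ => p + t • v) '' sphere 0 r) := by
    intro x hx t ht y hy
    refine mem_cthickening_of_dist_le _ (p + t • v) _ _ ⟨t, ht, rfl⟩ ?_
    have h1 : dist (x + t • v) (p + t • v) < δ / 2 := by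
      rw [dist_add_right]
      exact (mem_ball.1 hx).trans_le (min_le_left _ _)
    linarith [dist_triangle y (x + t • v) (p + t • v), mem_ball.1 hy]
  have hself : ∀ y : Fin n → ℂ, y ∈ ball y (δ / 2) := fun y => mem_ball_self (by positivity)
  have hdiff : ∀ x ∈ s, ∀ t ∈ sphere (0 : ℂ) r, DifferentiableAt ℂ g (x + t • v) := by
    intro x hx t ht
    have := hδW (hsδ x hx t ht (hself _))
    exact hd _ this.1 this.2
  have hmean : ∀ x ∈ s, g x = Real.circleAverage (fun t => g (x + t • v)) 0 r := by
    intro x hx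
    have hl : Continuous fun t : ℂ => x + t • v := by fun_prop
    have hr' : (r : ℂ) ∈ sphere (0 : ℂ) r := by simp [abs_of_pos hr]
    have hx0 : eval (x + (r : ℂ) • v) D ≠ 0 := (hδW (hsδ x hx r hr' (hself _))).2
    rw [circleAverage_of_differentiable_on_off_countable
      (finite_zeros_on_line D x v r hx0).countable]
    · simp
    · rw [abs_of_pos hr]
      exact hg.comp hl.continuousOn fun t ht => hsε x hx t ht
    · rw [abs_of_pos hr]
      rintro t ⟨ht, htD⟩
      refine DifferentiableAt.comp t
        (hd _ (hsε x hx t (ball_subset_closedBall ht)) htD) ?_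
      fun_prop
  have hcont : ∀ x ∈ s, Continuous fun θ : ℝ => g (x + circleMap 0 r θ • v) := by
    intro x hx
    refine hg.comp_continuous (by fun_prop) fun θ => ?_
    exact hsε x hx _ (sphere_subset_closedBall (hcirc θ))
  have hint : HasFDerivAt (fun x => ∫ θ in (0 : ℝ)..2 * Real.pi, g (x + circleMap 0 r θ • v))
      (∫ θ in (0 : ℝ)..2 * Real.pi, fderiv ℂ g (p + circleMap 0 r θ • v)) p := by
    refine intervalIntegral.hasFDerivAt_integral_of_dominated_of_fderiv_le
      (F' := fun x θ => fderiv ℂ g (x + circleMap 0 r θ • v))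
      (bound := fun _ => 2 * M / (δ / 2)) (ball_mem_nhds p hs0) ?_ ?_ ?_ ?_ ?_ ?_
    · filter_upwards [ball_mem_nhds p hs0] with x hx
      exact (hcont x hx).aestronglyMeasurable
    · exact (hcont p (mem_ball_self hs0)).intervalIntegrable _ _
    · refine Measurable.aestronglyMeasurable ?_
      exact (measurable_fderiv ℂ g).comp (Continuous.measurable (by fun_prop))
    · refine Eventually.of_forall fun θ _ x hx => ?_
      have hb := hsδ x hx _ (hcirc θ)
      refine Complex.norm_fderiv_le_div_of_mapsTo_ball
        (fun y hy => (hd y (hδW (hb hy)).1 (hδW (hb hy)).2).differentiableWithinAt) ?_ (by positivity)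
      intro y hy
      rw [mem_closedBall, dist_eq_norm]
      linarith [norm_sub_le (g y) (g (x + circleMap 0 r θ • v)), hM y (hb hy), hM _ (hb (hself _))]
    · exact intervalIntegrable_const
    · exact Eventually.of_forall fun θ _ x hx =>
        ((hasFDerivAt_comp_add_right _).2 (hdiff x hx _ (hcirc θ)).hasFDerivAt)
  have hev : g =ᶠ[𝓝 p] fun x =>
      ((2 * Real.pi)⁻¹ : ℝ) • ∫ θ in (0 : ℝ)..2 * Real.pi, g (x + circleMap 0 r θ • v) := by
    filter_upwards [ball_mem_nhds p hs0] with x hx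
    rw [hmean x hx, Real.circleAverage_def]
  exact ((hint.differentiableAt.const_smul ((2 * Real.pi)⁻¹ : ℝ)).congr_of_eventuallyEq hev)

end Analytic

section Action

variable {n : ℕ}

lemma gAct_one (z : Fin n → ℂ) : gAct 1 z = z := by
  simp [gAct]

lemma gAct_mul (σ τ : GL (Fin n) ℂ) (z : Fin n → ℂ) : gAct (σ * τ) z = gAct σ (gAct τ z) := by
  simp [gAct, Matrix.mulVec_mulVec]

lemma gAct_inv_gAct (σ : GL (Fin n) ℂ) (z : Fin n → ℂ) : gAct σ⁻¹ (gAct σ z) = z := by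
  rw [← gAct_mul, inv_mul_cancel, gAct_one]

lemma gAct_gAct_inv (σ : GL (Fin n) ℂ) (z : Fin n → ℂ) : gAct σ (gAct σ⁻¹ z) = z := by
  rw [← gAct_mul, mul_inv_cancel, gAct_one]

lemma gAct_add_smul (σ : GL (Fin n) ℂ) (z v : Fin n → ℂ) (t : ℂ) :
    gAct σ (z + t • v) = gAct σ z + t • gAct σ v := by
  simp [gAct, Matrix.mulVec_add, Matrix.mulVec_smul]

lemma continuous_gAct (σ : GL (Fin n) ℂ) : Continuous (gAct σ) :=
  continuous_const.matrix_mulVec continuous_id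

lemma isOpen_image_gAct (σ : GL (Fin n) ℂ) {V : Set (Fin n → ℂ)} (hV : IsOpen V) :
    IsOpen (gAct σ '' V) := by
  rw [Set.image_eq_preimage_of_inverse (gAct_inv_gAct σ) (gAct_gAct_inv σ)]
  exact hV.preimage (continuous_gAct σ⁻¹)

lemma eval_polyAct (σ : GL (Fin n) ℂ) (p : MvPolynomial (Fin n) ℂ) (z : Fin n → ℂ) :
    eval z (polyAct σ p) = eval (gAct σ⁻¹ z) p := by
  have : (aeval z).comp (aeval (fun i => ∑ j,
      C (((σ⁻¹ : GL (Fin n) ℂ) : Matrix (Fin n) (Fin n) ℂ) i j) * X j) :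
        MvPolynomial (Fin n) ℂ →ₐ[ℂ] MvPolynomial (Fin n) ℂ) = aeval (gAct σ⁻¹ z) := by
    ext i
    simp [gAct, Matrix.mulVec, dotProduct]
  simpa [polyAct, coe_aeval_eq_eval] using DFunLike.congr_fun this p

lemma eval_aeval_eq_eval_polyMap (θ : Fin n → MvPolynomial (Fin n) ℂ)
    (P : MvPolynomial (Fin n) ℂ) (z : Fin n → ℂ) :
    eval z (aeval θ P) = eval (polyMap θ z) P := by
  have : (aeval z).comp (aeval θ) = (aeval (polyMap θ z) : MvPolynomial (Fin n) ℂ →ₐ[ℂ] ℂ) := by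
    ext i
    simp [polyMap]
  simpa [coe_aeval_eq_eval] using DFunLike.congr_fun this P

/-- A polynomial separating a point from a finite set not containing it. -/
lemma exists_eval_ne_zero_and_eval_eq_zero {S : Set (Fin n → ℂ)} (hS : S.Finite)
    {w : Fin n → ℂ} (hw : w ∉ S) :
    ∃ h : MvPolynomial (Fin n) ℂ, eval w h ≠ 0 ∧ ∀ x ∈ S, eval x h = 0 := by
  have key : ∀ x : Fin n → ℂ, ∃ l : MvPolynomial (Fin n) ℂ, x ≠ w → eval w l ≠ 0 ∧ eval x l = 0 := by
    intro x
    by_cases hx : x = w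
    · exact ⟨0, fun h => absurd hx h⟩
    · obtain ⟨i, hi⟩ := Function.ne_iff.1 hx
      exact ⟨X i - C (x i), fun _ => ⟨by simpa [sub_eq_zero] using Ne.symm hi, by simp⟩⟩
  choose l hl using key
  refine ⟨∏ x ∈ hS.toFinset, l x, ?_, fun x hx => ?_⟩
  · rw [map_prod, Finset.prod_ne_zero_iff]
    intro x hx
    refine (hl x ?_).1
    rintro rfl
    exact hw (by simpa using hx)
  · rw [map_prod]
    exact Finset.prod_eq_zero (hS.mem_toFinset.2 hx) (hl x (by rintro rfl; exact hw hx)).2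

end Action

section Invariants

variable {n : ℕ} {G : Subgroup (GL (Fin n) ℂ)} {θ : Fin n → MvPolynomial (Fin n) ℂ}

lemma exists_eval_eq_eval_polyMap
    (hθgen : ∀ p : MvPolynomial (Fin n) ℂ,
      (∀ σ ∈ G, polyAct σ p = p) ↔ p ∈ Algebra.adjoin ℂ (Set.range θ))
    (p : MvPolynomial (Fin n) ℂ) (hp : ∀ σ ∈ G, ∀ z, eval (gAct σ z) p = eval z p) :
    ∃ P : MvPolynomial (Fin n) ℂ, ∀ z, eval z p = eval (polyMap θ z) P := by
  have : p ∈ Algebra.adjoin ℂ (Set.range θ) := (hθgen p).1 fun σ hσ =>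
    MvPolynomial.funext fun z => by rw [eval_polyAct, hp _ (G.inv_mem hσ)]
  rw [Algebra.adjoin_range_eq_range_aeval] at this
  obtain ⟨P, rfl⟩ := this
  exact ⟨P, fun z => eval_aeval_eq_eval_polyMap θ P z⟩

lemma polyMap_gAct
    (hθgen : ∀ p : MvPolynomial (Fin n) ℂ,
      (∀ σ ∈ G, polyAct σ p = p) ↔ p ∈ Algebra.adjoin ℂ (Set.range θ))
    {σ : GL (Fin n) ℂ} (hσ : σ ∈ G) (z : Fin n → ℂ) : polyMap θ (gAct σ z) = polyMap θ z := by
  funext i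
  have := (hθgen (θ i)).2 (Algebra.subset_adjoin ⟨i, rfl⟩) σ⁻¹ (G.inv_mem hσ)
  have h := eval_polyAct σ⁻¹ (θ i) z
  rw [this, inv_inv] at h
  exact h.symm

lemma exists_sum_eval_gAct [Fintype G]
    (hθgen : ∀ p : MvPolynomial (Fin n) ℂ,
      (∀ σ ∈ G, polyAct σ p = p) ↔ p ∈ Algebra.adjoin ℂ (Set.range θ))
    (h : MvPolynomial (Fin n) ℂ) :
    ∃ P : MvPolynomial (Fin n) ℂ, ∀ z,
      ∑ σ : G, eval (gAct (σ : GL (Fin n) ℂ) z) h = eval (polyMap θ z) P := by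
  have hsum : ∀ z, eval z (∑ σ : G, polyAct (σ : GL (Fin n) ℂ)⁻¹ h) =
      ∑ σ : G, eval (gAct (σ : GL (Fin n) ℂ) z) h := fun z => by
    simp [map_sum, eval_polyAct]
  obtain ⟨P, hP⟩ := exists_eval_eq_eval_polyMap hθgen (∑ σ : G, polyAct (σ : GL (Fin n) ℂ)⁻¹ h)
    fun τ hτ z => by
      rw [hsum, hsum]
      exact Fintype.sum_equiv (Equiv.mulRight ⟨τ, hτ⟩) _ _ fun σ => by simp [gAct_mul]
  exact ⟨P, fun z => by rw [← hsum, hP]⟩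

lemma eq_gAct_of_polyMap_eq [Finite G]
    (hθgen : ∀ p : MvPolynomial (Fin n) ℂ,
      (∀ σ ∈ G, polyAct σ p = p) ↔ p ∈ Algebra.adjoin ℂ (Set.range θ))
    {z w : Fin n → ℂ} (hzw : polyMap θ z = polyMap θ w) : ∃ σ ∈ G, gAct σ z = w := by
  classical
  have := Fintype.ofFinite G
  by_contra! hne
  obtain ⟨h, hw, hS⟩ := exists_eval_ne_zero_and_eval_eq_zero (w := w)
    (S := Set.range (fun σ : G => gAct (σ : GL (Fin n) ℂ) z) ∪
      (Set.range (fun σ : G => gAct (σ : GL (Fin n) ℂ) w) \ {w}))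
    ((Set.finite_range _).union (Set.finite_range _).sdiff) (by
      rintro (⟨σ, hσ⟩ | ⟨-, hw⟩)
      · exact hne σ σ.2 hσ
      · exact hw rfl)
  obtain ⟨P, hP⟩ := exists_sum_eval_gAct hθgen h
  have hz0 : ∑ σ : G, eval (gAct (σ : GL (Fin n) ℂ) z) h = 0 :=
    Finset.sum_eq_zero fun σ _ => hS _ (Or.inl ⟨σ, rfl⟩)
  have hw0 : ∑ σ : G, eval (gAct (σ : GL (Fin n) ℂ) w) h =
      ∑ σ : G, if gAct (σ : GL (Fin n) ℂ) w = w then eval w h else 0 := by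
    refine Finset.sum_congr rfl fun σ _ => ?_
    split_ifs with hσ
    · rw [hσ]
    · exact hS _ (Or.inr ⟨⟨σ, rfl⟩, hσ⟩)
  rw [hP, hzw, ← hP, hw0, ← Finset.sum_filter, Finset.sum_const, nsmul_eq_mul,
    mul_eq_zero, Nat.cast_eq_zero, Finset.card_eq_zero] at hz0
  refine hz0.elim (fun he => ?_) hw
  have : (1 : G) ∈ (∅ : Finset G) := he ▸ by simp [gAct_one]
  simp at this

/-- The discriminant: points over its nonvanishing locus have trivial stabilizer. -/
lemma exists_discriminant [Finite G]
    (hθgen : ∀ p : MvPolynomial (Fin n) ℂ,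
      (∀ σ ∈ G, polyAct σ p = p) ↔ p ∈ Algebra.adjoin ℂ (Set.range θ)) :
    ∃ D : MvPolynomial (Fin n) ℂ, (∃ z, eval (polyMap θ z) D ≠ 0) ∧
      ∀ z, eval (polyMap θ z) D ≠ 0 → ∀ σ ∈ G, gAct σ z = z → σ = 1 := by
  classical
  have := Fintype.ofFinite G
  have key : ∀ σ : G, ∃ m : MvPolynomial (Fin n) ℂ, m ≠ 0 ∧
      ∀ z, gAct (σ : GL (Fin n) ℂ) z = z → eval z m ≠ 0 → (σ : GL (Fin n) ℂ) = 1 := by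
    intro σ
    by_cases hσ : (σ : GL (Fin n) ℂ) = 1
    · exact ⟨1, one_ne_zero, fun _ _ _ => hσ⟩
    · obtain ⟨x, hx⟩ : ∃ x, gAct (σ : GL (Fin n) ℂ) x ≠ x := by
        by_contra! h
        refine hσ (Units.ext (Matrix.toLin'.injective (LinearMap.ext fun x => ?_)))
        simpa [gAct] using h x
      obtain ⟨i, hi⟩ := Function.ne_iff.1 hx
      have hev : ∀ z, eval z (∑ j, C (((σ : GL (Fin n) ℂ) : Matrix (Fin n) (Fin n) ℂ) i j) * X j
          - X i) = gAct (σ : GL (Fin n) ℂ) z i - z i := by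
        intro z
        simp [gAct, Matrix.mulVec, dotProduct]
      refine ⟨∑ j, C (((σ : GL (Fin n) ℂ) : Matrix (Fin n) (Fin n) ℂ) i j) * X j - X i,
        fun h0 => hi ?_, fun z hz hz0 => absurd ?_ hz0⟩
      · rw [← sub_eq_zero, ← hev x, h0, map_zero]
      · rw [hev z, hz, sub_self]
  choose m hm0 hm using key
  have hq0 : ∏ σ : G, m σ ≠ 0 := Finset.prod_ne_zero_iff.2 fun σ _ => hm0 σ
  have hprod : ∀ z, eval z (∏ τ : G, polyAct (τ : GL (Fin n) ℂ)⁻¹ (∏ σ : G, m σ)) =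
      ∏ τ : G, eval (gAct (τ : GL (Fin n) ℂ) z) (∏ σ : G, m σ) := by
    intro z
    rw [map_prod]
    simp only [eval_polyAct, inv_inv]
  obtain ⟨D, hD⟩ := exists_eval_eq_eval_polyMap hθgen
    (∏ τ : G, polyAct (τ : GL (Fin n) ℂ)⁻¹ (∏ σ : G, m σ)) fun τ hτ z => by
      rw [hprod, hprod]
      exact Fintype.prod_equiv (Equiv.mulRight ⟨τ, hτ⟩) _ _ fun σ => by simp [gAct_mul]
  refine ⟨D, ?_, fun z hz σ hσ hfix => ?_⟩
  · by_contra! h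
    have hzero : ∏ τ : G, polyAct (τ : GL (Fin n) ℂ)⁻¹ (∏ σ : G, m σ) = 0 :=
      MvPolynomial.funext fun z => by rw [hD, h, map_zero]
    obtain ⟨τ, -, hτ⟩ := Finset.prod_eq_zero_iff.1 hzero
    refine hq0 (MvPolynomial.funext fun z => ?_)
    have := eval_polyAct (τ : GL (Fin n) ℂ)⁻¹ (∏ σ : G, m σ) (gAct (τ : GL (Fin n) ℂ)⁻¹ z)
    rw [hτ, inv_inv, gAct_gAct_inv] at this
    rw [← this, map_zero, map_zero]
  · rw [← hD, hprod, Finset.prod_ne_zero_iff] at hz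
    have h1 := hz 1 (Finset.mem_univ _)
    rw [OneMemClass.coe_one, gAct_one, map_prod, Finset.prod_ne_zero_iff] at h1
    exact hm ⟨σ, hσ⟩ z hfix (h1 ⟨σ, hσ⟩ (Finset.mem_univ _))

lemma analyticAt_polyMap (θ : Fin n → MvPolynomial (Fin n) ℂ) (z : Fin n → ℂ) :
    AnalyticAt ℂ (polyMap θ) z :=
  AnalyticAt.pi fun i => analyticAt_eval (θ i) z

lemma continuous_polyMap (θ : Fin n → MvPolynomial (Fin n) ℂ) : Continuous (polyMap θ) :=
  continuous_pi fun i => MvPolynomial.continuous_eval (θ i)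

/-- At a point with trivial stabilizer the differential of `θ` is injective. -/
lemma fderiv_polyMap_injective [Finite G]
    (hθgen : ∀ p : MvPolynomial (Fin n) ℂ,
      (∀ σ ∈ G, polyAct σ p = p) ↔ p ∈ Algebra.adjoin ℂ (Set.range θ))
    {z : Fin n → ℂ} (hz : ∀ σ ∈ G, gAct σ z = z → σ = 1) :
    Function.Injective (fderiv ℂ (polyMap θ) z) := by
  classical
  have := Fintype.ofFinite G
  rw [injective_iff_map_eq_zero]
  intro v hv
  by_contra hv0
  obtain ⟨i, hi⟩ := Function.ne_iff.1 hv0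
  obtain ⟨h, hhz, hS⟩ := exists_eval_ne_zero_and_eval_eq_zero (w := z)
    (S := Set.range (fun σ : G => gAct (σ : GL (Fin n) ℂ) z) \ {z})
    (Set.finite_range _).sdiff (fun hz => hz.2 rfl)
  obtain ⟨P, hP⟩ := exists_sum_eval_gAct hθgen ((X i - C (z i)) * h ^ 2)
  have hline : HasDerivAt (fun t : ℂ => z + t • v) v 0 := by
    simpa using ((hasDerivAt_id (0 : ℂ)).smul_const v).const_add z
  have hzero : HasDerivAt (fun t : ℂ => eval (polyMap θ (z + t • v)) P) 0 0 := by
    have h1 : HasDerivAt (fun t : ℂ => polyMap θ (z + t • v)) (fderiv ℂ (polyMap θ) z v) 0 := by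
      have hθ : HasFDerivAt (polyMap θ) (fderiv ℂ (polyMap θ) z) (z + (0 : ℂ) • v) := by
        simpa using (analyticAt_polyMap θ z).differentiableAt.hasFDerivAt
      exact hθ.comp_hasDerivAt (0 : ℂ) hline
    rw [hv] at h1
    exact (HasFDerivAt.comp_hasDerivAt (0 : ℂ)
      (analyticAt_eval P (polyMap θ (z + (0 : ℂ) • v))).differentiableAt.hasFDerivAt h1).congr_deriv
      (map_zero _)
  have hterm : ∀ σ : G, HasDerivAt (fun t : ℂ =>
      eval (gAct (σ : GL (Fin n) ℂ) (z + t • v)) ((X i - C (z i)) * h ^ 2))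
      (if σ = 1 then v i * eval z h ^ 2 else 0) 0 := by
    intro σ
    have ha : HasDerivAt (fun t : ℂ => gAct (σ : GL (Fin n) ℂ) z + t • gAct (σ : GL (Fin n) ℂ) v)
        (gAct (σ : GL (Fin n) ℂ) v) 0 := by
      simpa using ((hasDerivAt_id (0 : ℂ)).smul_const (gAct (σ : GL (Fin n) ℂ) v)).const_add
        (gAct (σ : GL (Fin n) ℂ) z)
    have hb := HasFDerivAt.comp_hasDerivAt (0 : ℂ) (analyticAt_eval h (gAct (σ : GL (Fin n) ℂ) z +
      (0 : ℂ) • gAct (σ : GL (Fin n) ℂ) v)).differentiableAt.hasFDerivAt ha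
    have hc := ((hasDerivAt_pi.1 ha i).sub_const (z i)).mul (hb.pow 2)
    simp only [gAct_add_smul, map_mul, map_sub, map_pow, eval_X, eval_C]
    refine hc.congr_deriv ?_
    split_ifs with hσ
    · subst hσ
      simp [gAct_one]
    · have : eval (gAct (σ : GL (Fin n) ℂ) z) h = 0 :=
        hS _ ⟨⟨σ, rfl⟩, fun hfix => hσ (Subtype.ext (hz σ σ.2 hfix))⟩
      simp [this]
  have hsum := HasDerivAt.fun_sum fun (σ : G) (_ : σ ∈ Finset.univ) => hterm σ
  simp only [hP, Finset.sum_ite_eq', Finset.mem_univ, if_true] at hsum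
  have := hzero.unique hsum
  simp [hhz] at this
  exact hi (by simpa using this)

end Invariants

section Quotient

open Metric Filter Set
open scoped Topology

variable {n : ℕ} {G : Subgroup (GL (Fin n) ℂ)} {θ : Fin n → MvPolynomial (Fin n) ℂ}

lemma eval_smul_of_isHomogeneous {p : MvPolynomial (Fin n) ℂ} {d : ℕ} (hp : p.IsHomogeneous d)
    (t : ℂ) (z : Fin n → ℂ) : eval (t • z) p = t ^ d * eval z p := by
  rw [eval_eq', eval_eq', Finset.mul_sum]
  refine Finset.sum_congr rfl fun m hm => ?_
  have hdeg : ∑ i, m i = d := by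
    rw [← hp (mem_support_iff.1 hm), Finsupp.weight_apply, Finsupp.sum_fintype _ _ (by simp)]
    simp
  simp only [Pi.smul_apply, smul_eq_mul, mul_pow, Finset.prod_mul_distrib,
    Finset.prod_pow_eq_pow_sum, hdeg]
  ring

lemma degree_ne_zero_of_algebraicIndependent {dd : Fin n → ℕ}
    (hθhom : ∀ i, (θ i).IsHomogeneous (dd i)) (hθalg : AlgebraicIndependent ℂ θ) (i : Fin n) :
    dd i ≠ 0 := by
  intro h0
  have h1 := hθhom i
  rw [h0, ← totalDegree_zero_iff_isHomogeneous, totalDegree_eq_zero_iff_eq_C] at h1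
  have h2 : (X i : MvPolynomial (Fin n) ℂ) = C (coeff 0 (θ i)) := by
    apply hθalg
    rw [aeval_X, aeval_C, algebraMap_eq]
    exact h1
  have h3 := congrArg (eval fun _ => coeff 0 (θ i) + 1) h2
  simp at h3

lemma exists_norm_le_norm_polyMap [Finite G] {dd : Fin n → ℕ}
    (hθhom : ∀ i, (θ i).IsHomogeneous (dd i)) (hdd : ∀ i, dd i ≠ 0)
    (hθgen : ∀ p : MvPolynomial (Fin n) ℂ,
      (∀ σ ∈ G, polyAct σ p = p) ↔ p ∈ Algebra.adjoin ℂ (Set.range θ)) :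
    ∃ c > 0, ∀ z, 1 ≤ ‖z‖ → c * ‖z‖ ≤ ‖polyMap θ z‖ := by
  have hsmul : ∀ (t : ℂ) z i, polyMap θ (t • z) i = t ^ dd i * polyMap θ z i :=
    fun t z i => eval_smul_of_isHomogeneous (hθhom i) t z
  obtain ⟨c, hc, hcs⟩ := (isCompact_sphere (0 : Fin n → ℂ) 1).exists_forall_le'
    (continuous_polyMap θ).norm.continuousOn (a := 0) (by
      intro z hz
      refine norm_pos_iff.2 fun h0 => ?_
      have h0' : polyMap θ 0 = 0 := by
        funext i
        simpa [hdd i] using hsmul 0 0 i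
      obtain ⟨σ, -, hσ⟩ := eq_gAct_of_polyMap_eq hθgen (h0'.trans h0.symm)
      have : z = 0 := by rw [← hσ, gAct, Matrix.mulVec_zero]
      simp [this] at hz)
  refine ⟨c, hc, fun z hz => ?_⟩
  have hz0 : 0 < ‖z‖ := by linarith
  rw [← le_div_iff₀ hz0]
  refine (hcs (((‖z‖⁻¹ : ℝ) : ℂ) • z) ?_).trans ?_
  · rw [mem_sphere_zero_iff_norm, norm_smul, Complex.norm_real, norm_inv, norm_norm,
      inv_mul_cancel₀ hz0.ne']
  · rw [pi_norm_le_iff_of_nonneg (by positivity)]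
    intro i
    rw [hsmul, norm_mul, norm_pow, Complex.norm_real, norm_inv, norm_norm, div_eq_inv_mul]
    gcongr
    · exact pow_le_of_le_one (by positivity) (inv_le_one_of_one_le₀ hz) (hdd i)
    · exact norm_le_pi_norm (polyMap θ z) i

lemma isClosedMap_polyMap [Finite G] {dd : Fin n → ℕ}
    (hθhom : ∀ i, (θ i).IsHomogeneous (dd i)) (hdd : ∀ i, dd i ≠ 0)
    (hθgen : ∀ p : MvPolynomial (Fin n) ℂ,
      (∀ σ ∈ G, polyAct σ p = p) ↔ p ∈ Algebra.adjoin ℂ (Set.range θ)) :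
    IsClosedMap (polyMap θ) := by
  obtain ⟨c, hc, hcz⟩ := exists_norm_le_norm_polyMap hθhom hdd hθgen
  refine (isProperMap_iff_tendsto_cocompact.2 ⟨continuous_polyMap θ, ?_⟩).isClosedMap
  rw [← cobounded_eq_cocompact, ← tendsto_norm_atTop_iff_cobounded]
  refine tendsto_atTop_mono' _ ?_ (tendsto_norm_cobounded_atTop.const_mul_atTop hc)
  filter_upwards [tendsto_norm_cobounded_atTop.eventually_ge_atTop 1] with z hz
  exact hcz z hz

/-- The strict differential of `θ` at a point with trivial stabilizer is invertible. -/
lemma exists_hasStrictFDerivAt_equiv [Finite G]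
    (hθgen : ∀ p : MvPolynomial (Fin n) ℂ,
      (∀ σ ∈ G, polyAct σ p = p) ↔ p ∈ Algebra.adjoin ℂ (Set.range θ))
    {z : Fin n → ℂ} (hz : ∀ σ ∈ G, gAct σ z = z → σ = 1) :
    ∃ A : (Fin n → ℂ) ≃L[ℂ] (Fin n → ℂ),
      HasStrictFDerivAt (polyMap θ) (A : (Fin n → ℂ) →L[ℂ] (Fin n → ℂ)) z := by
  have hinj := fderiv_polyMap_injective hθgen hz
  refine ⟨(LinearEquiv.ofInjectiveEndo (fderiv ℂ (polyMap θ) z : (Fin n → ℂ) →ₗ[ℂ] (Fin n → ℂ))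
    hinj).toContinuousLinearEquiv, ?_⟩
  exact (analyticAt_polyMap θ z).hasStrictFDerivAt.congr_fderiv (ContinuousLinearMap.ext fun _ => rfl)

lemma surjective_polyMap [Finite G] {dd : Fin n → ℕ}
    (hθhom : ∀ i, (θ i).IsHomogeneous (dd i)) (hdd : ∀ i, dd i ≠ 0)
    (hθgen : ∀ p : MvPolynomial (Fin n) ℂ,
      (∀ σ ∈ G, polyAct σ p = p) ↔ p ∈ Algebra.adjoin ℂ (Set.range θ)) :
    Function.Surjective (polyMap θ) := by
  obtain ⟨D, ⟨z₀, hz₀⟩, hD⟩ := exists_discriminant hθgen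
  have hclosed : IsClosed (range (polyMap θ)) := (isClosedMap_polyMap hθhom hdd hθgen).isClosed_range
  have hopen : IsOpen (range (polyMap θ) ∩ {y | eval y D ≠ 0}) := by
    rw [isOpen_iff_mem_nhds]
    rintro _ ⟨⟨z, rfl⟩, hz⟩
    obtain ⟨A, hA⟩ := exists_hasStrictFDerivAt_equiv hθgen (hD z hz)
    refine inter_mem ?_ ((isOpen_ne_fun (continuous_eval D) continuous_const).mem_nhds hz)
    rw [← hA.map_nhds_eq_of_equiv]
    exact range_mem_map
  have hreg : ∀ b, eval b D ≠ 0 → b ∈ range (polyMap θ) := by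
    intro b hb
    set a := polyMap θ z₀ with ha
    have hline : Continuous fun t : ℂ => a + t • (b - a) := by fun_prop
    have hfin := finite_zeros_on_line D a (b - a) 0 (by simpa using hz₀)
    have hpre : IsPreconnected ({t : ℂ | eval (a + t • (b - a)) D = 0}ᶜ) :=
      (hfin.countable.isConnected_compl_of_one_lt_rank (by simp)).isPreconnected
    have hsub := hpre.subset_of_closure_inter_subset (hopen.preimage hline)
      ⟨0, by simpa using hz₀, by simpa using ⟨⟨z₀, ha.symm⟩, hz₀⟩⟩ (by
        rintro t ⟨ht, htD⟩
        exact ⟨closure_minimal (preimage_mono inter_subset_left) (hclosed.preimage hline) ht, htD⟩)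
    have h1 := hsub (show (1 : ℂ) ∈ _ by simpa using hb)
    simpa using h1.1
  intro b
  suffices b ∈ closure {y | eval y D ≠ 0} from
    closure_minimal hreg hclosed this
  have hline : Continuous fun t : ℂ => b + t • (polyMap θ z₀ - b) := by fun_prop
  have hfin := finite_zeros_on_line D b (polyMap θ z₀ - b) 1 (by simpa using hz₀)
  have hdense := hfin.countable.dense_compl ℂ (0 : ℂ)
  have := image_closure_subset_closure_image hline ⟨0, hdense, rfl⟩
  simp only [zero_smul, add_zero] at this
  refine closure_mono ?_ this
  rintro _ ⟨t, ht, rfl⟩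
  exact ht

lemma isOpenMap_polyMap [Finite G] {dd : Fin n → ℕ}
    (hθhom : ∀ i, (θ i).IsHomogeneous (dd i)) (hdd : ∀ i, dd i ≠ 0)
    (hθgen : ∀ p : MvPolynomial (Fin n) ℂ,
      (∀ σ ∈ G, polyAct σ p = p) ↔ p ∈ Algebra.adjoin ℂ (Set.range θ)) :
    IsOpenMap (polyMap θ) := by
  intro V hV
  have hquot := (isClosedMap_polyMap hθhom hdd hθgen).isQuotientMap (continuous_polyMap θ)
    (surjective_polyMap hθhom hdd hθgen)
  rw [← hquot.isOpen_preimage]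
  have : polyMap θ ⁻¹' (polyMap θ '' V) = ⋃ σ ∈ G, gAct σ '' V := by
    ext z
    simp only [mem_preimage, mem_image, mem_iUnion, exists_prop]
    constructor
    · rintro ⟨x, hx, hxz⟩
      obtain ⟨σ, hσ, rfl⟩ := eq_gAct_of_polyMap_eq hθgen hxz
      exact ⟨σ, hσ, x, hx, rfl⟩
    · rintro ⟨σ, hσ, x, hx, rfl⟩
      exact ⟨x, hx, (polyMap_gAct hθgen hσ x).symm⟩
  rw [this]
  exact isOpen_biUnion fun σ _ => isOpen_image_gAct σ hV

end Quotient

/-- **Analytic CST on `G`-invariant domains (invariant form).**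
If `Ω ⊆ ℂⁿ` is a `G`-invariant domain and `f` is holomorphic and `G`-invariant on `Ω`,
then `f = g ∘ θ` for a function `g` holomorphic on `θ(Ω)`, and `g` is unique on `θ(Ω)`. -/
theorem analytic_CST_invariant_domain {n : ℕ} (G : Subgroup (GL (Fin n) ℂ)) [Finite G]
    (hG : IsPseudoreflectionGroup G)
    (θ : Fin n → MvPolynomial (Fin n) ℂ) (dd : Fin n → ℕ)
    (hθhom : ∀ i, (θ i).IsHomogeneous (dd i))
    (hθalg : AlgebraicIndependent ℂ θ)
    (hθgen : ∀ p : MvPolynomial (Fin n) ℂ,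
      (∀ σ ∈ G, polyAct σ p = p) ↔ p ∈ Algebra.adjoin ℂ (Set.range θ))
    (Ω : Set (Fin n → ℂ)) (hΩopen : IsOpen Ω) (hΩconn : IsConnected Ω)
    (hΩinv : ∀ σ ∈ G, gAct σ '' Ω = Ω)
    (f : (Fin n → ℂ) → ℂ) (hf : DifferentiableOn ℂ f Ω)
    (hfinv : ∀ σ ∈ G, ∀ z ∈ Ω, f (gAct σ z) = f z) :
    ∃ g : (Fin n → ℂ) → ℂ,
      (DifferentiableOn ℂ g (polyMap θ '' Ω) ∧ ∀ z ∈ Ω, f z = g (polyMap θ z)) ∧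
      ∀ g' : (Fin n → ℂ) → ℂ,
        DifferentiableOn ℂ g' (polyMap θ '' Ω) → (∀ z ∈ Ω, f z = g' (polyMap θ z)) →
        Set.EqOn g g' (polyMap θ '' Ω) := by
  classical
  have hdd := degree_ne_zero_of_algebraicIndependent hθhom hθalg
  have hopen := isOpenMap_polyMap hθhom hdd hθgen
  obtain ⟨D, ⟨z₀, hz₀⟩, hD⟩ := exists_discriminant hθgen
  have hD0 : D ≠ 0 := by
    rintro rfl
    exact hz₀ (map_zero _)
  obtain ⟨g, hg⟩ : ∃ g : (Fin n → ℂ) → ℂ, ∀ z ∈ Ω, f z = g (polyMap θ z) := by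
    refine ⟨fun y => if h : ∃ z ∈ Ω, polyMap θ z = y then f h.choose else 0, fun z hz => ?_⟩
    have h : ∃ w ∈ Ω, polyMap θ w = polyMap θ z := ⟨z, hz, rfl⟩
    simp only [dif_pos h]
    obtain ⟨σ, hσ, hσz⟩ := eq_gAct_of_polyMap_eq hθgen h.choose_spec.2
    rw [← hfinv σ hσ _ h.choose_spec.1, hσz]
  have hcont : ContinuousOn g (polyMap θ '' Ω) := by
    rintro _ ⟨z, hz, rfl⟩
    refine ContinuousAt.continuousWithinAt fun N hN => ?_
    rw [← hg z hz] at hN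
    have h1 := (hf.continuousOn.continuousAt (hΩopen.mem_nhds hz)) hN
    rw [Filter.mem_map]
    refine Filter.mem_of_superset
      (hopen.image_mem_nhds (Filter.inter_mem h1 (hΩopen.mem_nhds hz))) ?_
    rintro _ ⟨w, ⟨hwN, hwΩ⟩, rfl⟩
    rw [Set.mem_preimage, ← hg w hwΩ]
    exact hwN
  refine ⟨g, ⟨fun y hy => (differentiableAt_of_continuousOn_off_zeros (hopen Ω hΩopen) hcont hD0
    ?_ hy).differentiableWithinAt, hg⟩, ?_⟩
  · rintro _ ⟨z, hz, rfl⟩ hzD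
    obtain ⟨A, hA⟩ := exists_hasStrictFDerivAt_equiv hθgen (hD z hzD)
    have hinv := hA.to_localInverse.hasFDerivAt.differentiableAt
    have hval : hA.localInverse (polyMap θ) A z (polyMap θ z) = z := hA.localInverse_apply_image
    have hfz : DifferentiableAt ℂ f (hA.localInverse (polyMap θ) A z (polyMap θ z)) := by
      rw [hval]
      exact hf.differentiableAt (hΩopen.mem_nhds hz)
    refine (hfz.comp _ hinv).congr_of_eventuallyEq ?_
    have hmem := hA.localInverse_tendsto.eventually (hΩopen.mem_nhds hz)
    filter_upwards [hmem, hA.eventually_right_inverse] with y hyΩ hyr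
    rw [Function.comp_apply, hg _ hyΩ, hyr]
  · rintro g' - hg' _ ⟨z, hz, rfl⟩
    rw [← hg z hz, hg' z hz]
end
end

section
/- Let G be a finite group, H a complex Hilbert space, U : G → B(H) a unitary representation, and π : G → U(m) an irreducible unitary matrix representation. Then for all 1 ≤ i,j ≤ m, (P_π^{ij})* ∘ P_π^{ij} = P_π^{jj}, where (P_π^{ij})* denotes the Hilbert-space adjoint of the bounded operator P_π^{ij}. -/
noncomputable section

/-- A unitary matrix representation is irreducible if the only subspaces of `ℂᵐ` invariant
under all `π σ` are `{0}` and `ℂᵐ`. -/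
def MatIrreducible {G : Type*} [Group G] {m : ℕ}
    (π : G →* Matrix.unitaryGroup (Fin m) ℂ) : Prop :=
  ∀ W : Submodule ℂ (Fin m → ℂ),
    (∀ σ : G, ∀ v ∈ W, Matrix.mulVec (π σ : Matrix (Fin m) (Fin m) ℂ) v ∈ W) →
    W = ⊥ ∨ W = ⊤

/-- Two matrix representations are equivalent if they are intertwined by an invertible
matrix. -/
def MatEquiv {G : Type*} [Group G] {m m' : ℕ}
    (π : G →* Matrix.unitaryGroup (Fin m) ℂ)
    (π' : G →* Matrix.unitaryGroup (Fin m') ℂ) : Prop :=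
  ∃ (A : Matrix (Fin m') (Fin m) ℂ) (B : Matrix (Fin m) (Fin m') ℂ),
    A * B = 1 ∧ B * A = 1 ∧
    ∀ σ : G, A * (π σ : Matrix (Fin m) (Fin m) ℂ) = (π' σ : Matrix (Fin m') (Fin m') ℂ) * A

/-- The operator `P_π^{ij} = (m/|G|)·Σ_{σ∈G} π(σ⁻¹)_{ji}·U(σ)`. -/
def Pij {G : Type*} [Group G] [Fintype G]
    {H : Type*} [NormedAddCommGroup H] [InnerProductSpace ℂ H]
    (U : G →* (H →L[ℂ] H)) {m : ℕ} (π : G →* Matrix.unitaryGroup (Fin m) ℂ)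
    (i j : Fin m) : H →L[ℂ] H :=
  ((m : ℂ) / (Fintype.card G : ℂ)) •
    ∑ σ : G, ((π σ⁻¹ : Matrix (Fin m) (Fin m) ℂ) j i) • U σ

/-- The operator `P_π = (m/|G|)·Σ_{σ∈G} χ_π(σ⁻¹)·U(σ)`, `χ_π = trace ∘ π`. -/
def Pproj {G : Type*} [Group G] [Fintype G]
    {H : Type*} [NormedAddCommGroup H] [InnerProductSpace ℂ H]
    (U : G →* (H →L[ℂ] H)) {m : ℕ} (π : G →* Matrix.unitaryGroup (Fin m) ℂ) :
    H →L[ℂ] H :=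
  ((m : ℂ) / (Fintype.card G : ℂ)) •
    ∑ σ : G, (Matrix.trace (π σ⁻¹ : Matrix (Fin m) (Fin m) ℂ)) • U σ


/-- **Schur's lemma**: a matrix commuting with an irreducible representation is scalar. -/
theorem MatIrreducible.exists_eq_smul_one {G : Type*} [Group G] {m : ℕ} [NeZero m]
    {π : G →* Matrix.unitaryGroup (Fin m) ℂ} (hπ : MatIrreducible π)
    (T : Matrix (Fin m) (Fin m) ℂ)
    (hT : ∀ σ : G, (π σ : Matrix (Fin m) (Fin m) ℂ) * T = T * π σ) :
    ∃ c : ℂ, T = c • (1 : Matrix (Fin m) (Fin m) ℂ) := by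
  obtain ⟨c, hc⟩ := Module.End.exists_eigenvalue (Matrix.toLin' T)
  refine ⟨c, ?_⟩
  have htop : Module.End.eigenspace (Matrix.toLin' T) c = ⊤ := by
    refine (hπ _ fun σ v hv => ?_).resolve_left hc
    rw [Module.End.mem_eigenspace_iff, Matrix.toLin'_apply] at hv ⊢
    rw [Matrix.mulVec_mulVec, ← hT, ← Matrix.mulVec_mulVec, hv, Matrix.mulVec_smul]
  refine Matrix.toLin'.injective (LinearMap.ext fun v => ?_)
  have hv : v ∈ Module.End.eigenspace (Matrix.toLin' T) c := htop ▸ Submodule.mem_top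
  simpa [Matrix.smul_mulVec] using Module.End.mem_eigenspace_iff.mp hv

/-- The average of the conjugates of a matrix by an irreducible representation is scalar. -/
theorem MatIrreducible.sum_conj {G : Type*} [Group G] [Fintype G] {m : ℕ} [NeZero m]
    {π : G →* Matrix.unitaryGroup (Fin m) ℂ} (hπ : MatIrreducible π)
    (A : Matrix (Fin m) (Fin m) ℂ) :
    ∑ σ : G, (π σ : Matrix (Fin m) (Fin m) ℂ) * A * (π σ⁻¹ : Matrix (Fin m) (Fin m) ℂ) =
      ((Fintype.card G : ℂ) / m * A.trace) • (1 : Matrix (Fin m) (Fin m) ℂ) := by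
  have hm : (m : ℂ) ≠ 0 := Nat.cast_ne_zero.mpr (NeZero.ne m)
  have hinv (σ : G) : (π σ⁻¹ : Matrix (Fin m) (Fin m) ℂ) * (π σ : Matrix _ _ ℂ) = 1 := by
    rw [← Matrix.UnitaryGroup.mul_val, ← map_mul, inv_mul_cancel, map_one,
      Matrix.UnitaryGroup.one_val]
  obtain ⟨c, hc⟩ := hπ.exists_eq_smul_one
    (∑ σ : G, (π σ : Matrix (Fin m) (Fin m) ℂ) * A * (π σ⁻¹ : Matrix (Fin m) (Fin m) ℂ)) (by
      intro τ
      rw [Finset.mul_sum, Finset.sum_mul]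
      refine Fintype.sum_equiv (Equiv.mulLeft τ) _ _ fun σ => ?_
      rw [Equiv.coe_mulLeft, mul_inv_rev, map_mul, map_mul, Matrix.UnitaryGroup.mul_val,
        Matrix.UnitaryGroup.mul_val]
      simp only [Matrix.mul_assoc]
      rw [hinv, Matrix.mul_one])
  have htr := congrArg Matrix.trace hc
  have hterm (σ : G) : ((π σ : Matrix (Fin m) (Fin m) ℂ) * A *
      (π σ⁻¹ : Matrix (Fin m) (Fin m) ℂ)).trace = A.trace := by
    rw [Matrix.trace_mul_comm, ← Matrix.mul_assoc, hinv, Matrix.one_mul]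
  simp only [Matrix.trace_sum, hterm, Finset.sum_const, Finset.card_univ, nsmul_eq_mul,
    Matrix.trace_smul, Matrix.trace_one, Fintype.card_fin, smul_eq_mul] at htr
  rw [hc]
  congr 1
  field_simp
  exact htr.symm

/-- Schur orthogonality for the matrix coefficients of an irreducible representation. -/
theorem MatIrreducible.sum_coeff_mul_coeff_inv {G : Type*} [Group G] [Fintype G] {m : ℕ}
    {π : G →* Matrix.unitaryGroup (Fin m) ℂ} (hπ : MatIrreducible π) (a b k l : Fin m) :
    ∑ σ : G, (π σ : Matrix (Fin m) (Fin m) ℂ) a k * (π σ⁻¹ : Matrix (Fin m) (Fin m) ℂ) l b =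
      if a = b ∧ k = l then (Fintype.card G : ℂ) / m else 0 := by
  have : NeZero m := ⟨a.pos.ne'⟩
  have h := congrFun (congrFun (hπ.sum_conj (Matrix.single k l 1)) a) b
  rw [Matrix.sum_apply] at h
  simp only [Matrix.mul_apply, Matrix.single_apply, Matrix.smul_apply, Matrix.one_apply] at h
  by_cases hkl : k = l
  · subst hkl
    simpa [ite_and, Finset.sum_mul] using h
  · simpa [ite_and, hkl, Matrix.trace_single_eq_of_ne] using h

/-- The operators `P_π^{ij}` of an irreducible `π` multiply like matrix units. -/
theorem Pij_mul_Pij {G : Type*} [Group G] [Fintype G]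
    {H : Type*} [NormedAddCommGroup H] [InnerProductSpace ℂ H]
    (U : G →* (H →L[ℂ] H)) {m : ℕ} {π : G →* Matrix.unitaryGroup (Fin m) ℂ}
    (hπ : MatIrreducible π) (i j k l : Fin m) :
    Pij U π i j * Pij U π k l = if j = k then Pij U π i l else 0 := by
  have hm : (m : ℂ) ≠ 0 := Nat.cast_ne_zero.mpr i.pos.ne'
  have hG : (Fintype.card G : ℂ) ≠ 0 := Nat.cast_ne_zero.mpr Fintype.card_ne_zero
  have hcoeff (ρ : G) : ∑ σ : G, (π σ⁻¹ : Matrix (Fin m) (Fin m) ℂ) j i *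
      (π (σ⁻¹ * ρ)⁻¹ : Matrix (Fin m) (Fin m) ℂ) l k =
      (if j = k then (Fintype.card G : ℂ) / m else 0) *
        (π ρ⁻¹ : Matrix (Fin m) (Fin m) ℂ) l i := by
    simp only [mul_inv_rev, inv_inv, map_mul, Matrix.UnitaryGroup.mul_val, Matrix.mul_apply,
      Finset.mul_sum]
    rw [Finset.sum_comm]
    calc _ = ∑ b, (π ρ⁻¹ : Matrix (Fin m) (Fin m) ℂ) l b *
          ∑ σ : G, (π σ : Matrix (Fin m) (Fin m) ℂ) b k *
            (π σ⁻¹ : Matrix (Fin m) (Fin m) ℂ) j i := by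
          simp only [Finset.mul_sum]
          exact Finset.sum_congr rfl fun b _ => Finset.sum_congr rfl fun σ _ => by
            rw [map_inv]; ring
      _ = _ := by
          simp only [hπ.sum_coeff_mul_coeff_inv]
          simp [-map_inv, ite_and, eq_comm (a := k), mul_comm]
  have hsum : (∑ σ : G, (π σ⁻¹ : Matrix (Fin m) (Fin m) ℂ) j i • U σ) *
      (∑ τ : G, (π τ⁻¹ : Matrix (Fin m) (Fin m) ℂ) l k • U τ) =
      (if j = k then (Fintype.card G : ℂ) / m else 0) •
        ∑ ρ : G, (π ρ⁻¹ : Matrix (Fin m) (Fin m) ℂ) l i • U ρ := by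
    rw [Finset.sum_mul_sum, Finset.smul_sum]
    simp only [smul_smul, ← hcoeff, Finset.sum_smul]
    rw [Finset.sum_comm (s := Finset.univ) (t := Finset.univ)
      (f := fun ρ σ => ((π σ⁻¹ : Matrix (Fin m) (Fin m) ℂ) j i *
        (π (σ⁻¹ * ρ)⁻¹ : Matrix (Fin m) (Fin m) ℂ) l k) • U ρ)]
    refine Finset.sum_congr rfl fun σ _ => Fintype.sum_equiv (Equiv.mulLeft σ) _ _ fun τ => ?_
    rw [smul_mul_smul_comm, ← map_mul, Equiv.coe_mulLeft, inv_mul_cancel_left]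
  rw [Pij, Pij, smul_mul_smul_comm, hsum, smul_smul]
  split_ifs
  · rw [Pij]
    congr 1
    field_simp
  · simp

/-- For unitary `U`, the adjoint of `P_π^{ij}` is `P_π^{ji}`. -/
theorem adjoint_Pij {G : Type*} [Group G] [Fintype G]
    {H : Type*} [NormedAddCommGroup H] [InnerProductSpace ℂ H] [CompleteSpace H]
    (U : G →* (H →L[ℂ] H)) (hU : ∀ σ : G, U σ ∈ unitary (H →L[ℂ] H))
    {m : ℕ} (π : G →* Matrix.unitaryGroup (Fin m) ℂ) (i j : Fin m) :
    ContinuousLinearMap.adjoint (Pij U π i j) = Pij U π j i := by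
  have hstar (σ : G) : star (U σ) = U σ⁻¹ :=
    left_inv_eq_right_inv (Unitary.star_mul_self_of_mem (hU σ))
      (by rw [← map_mul, mul_inv_cancel, map_one])
  have hcoeff (σ : G) : star ((π σ⁻¹ : Matrix (Fin m) (Fin m) ℂ) j i) =
      (π σ : Matrix (Fin m) (Fin m) ℂ) i j := by
    rw [map_inv, Matrix.UnitaryGroup.inv_val, Matrix.star_apply, star_star]
  rw [← ContinuousLinearMap.star_eq_adjoint, Pij, Pij, star_smul, star_sum]
  congr 1
  · simp
  · refine Fintype.sum_equiv (Equiv.inv G) _ _ fun σ => ?_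
    rw [star_smul, hcoeff, hstar, Equiv.inv_apply, inv_inv]

/-- For an irreducible unitary matrix representation `π` of a finite group `G` and a
unitary representation `U` on a Hilbert space `H`: `(P_π^{ij})* ∘ P_π^{ij} = P_π^{jj}`. -/
theorem adjoint_Pij_comp_Pij {G : Type*} [Group G] [Fintype G]
    {H : Type*} [NormedAddCommGroup H] [InnerProductSpace ℂ H] [CompleteSpace H]
    (U : G →* (H →L[ℂ] H)) (hU : ∀ σ : G, U σ ∈ unitary (H →L[ℂ] H))
    {m : ℕ} (π : G →* Matrix.unitaryGroup (Fin m) ℂ) (hπ : MatIrreducible π)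
    (i j : Fin m) :
    (ContinuousLinearMap.adjoint (Pij U π i j)).comp (Pij U π i j) = Pij U π j j := by
  rw [adjoint_Pij U hU, ← ContinuousLinearMap.mul_def, Pij_mul_Pij U hπ, if_pos rfl]
end
end
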